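/- arXiv:2502.10138 — 11 statements merged into one kernel-verified Lean document; each statement's English description precedes it below -/
import Mathlib

section
/- Mixture policy feasibility (bandit). Let ξ > 0, C_p > 0, b ∈ ℝ. Let π_sf and π_⋆ be probability measures on A, and write u_sf = ∫u dπ_sf, u_⋆ = ∫u dπ_⋆, β_sf = ∫β dπ_sf, β_⋆ = ∫β dπ_⋆. Assume u_sf − b ≥ ξ, u_⋆ ≥ b, 2·C_p·β_sf ≤ ξ, and ξ − 2C_p·β_sf + 2C_p·β_⋆ > 0. Set α̂ = (ξ − 2C_p·β_sf)/(ξ − 2C_p·β_sf + 2C_p·β_⋆). Then for every α ∈ [0, α̂], the mixture measure π_α = (1−α)·π_sf + α·π_⋆ satisfies ∫u dπ_α − 2C_p·∫β dπ_α ≥ b. -/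
open MeasureTheory

/-- The integral of a bounded measurable function against a mixture of two probability measures
is the corresponding convex combination of integrals. -/
theorem integral_mixture_of_bounded {A : Type*} [MeasurableSpace A] (μ ν : Measure A)
    [IsProbabilityMeasure μ] [IsProbabilityMeasure ν] {f : A → ℝ} (hf : Measurable f)
    (hf_bdd : ∃ C, ∀ a, |f a| ≤ C) {α : ℝ} (h0 : 0 ≤ α) (h1 : α ≤ 1) :
    ∫ a, f a ∂(ENNReal.ofReal (1 - α) • μ + ENNReal.ofReal α • ν) =
      (1 - α) * (∫ a, f a ∂μ) + α * (∫ a, f a ∂ν) := by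
  obtain ⟨C, hC⟩ := hf_bdd
  have hint (ρ : Measure A) [IsProbabilityMeasure ρ] : Integrable f ρ :=
    Integrable.of_bound hf.aestronglyMeasurable C (Filter.Eventually.of_forall hC)
  rw [integral_add_measure ((hint μ).smul_measure ENNReal.ofReal_ne_top)
      ((hint ν).smul_measure ENNReal.ofReal_ne_top),
    integral_smul_measure, integral_smul_measure, ENNReal.toReal_ofReal (sub_nonneg.2 h1),
    ENNReal.toReal_ofReal h0, smul_eq_mul, smul_eq_mul]

/-- **Mixture policy feasibility (bandit).**
If the safe policy is strictly feasible (`u_sf − b ≥ ξ`), the optimal policy is feasible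
(`u_⋆ ≥ b`), the safe policy's scaled bonus is small (`2·C_p·β_sf ≤ ξ`), and the denominator
`ξ − 2C_p·β_sf + 2C_p·β_⋆` is positive, then for every `α` in `[0, α̂]` with
`α̂ = (ξ − 2C_p·β_sf)/(ξ − 2C_p·β_sf + 2C_p·β_⋆)`, the mixture measure
`π_α = (1−α)·π_sf + α·π_⋆` satisfies `∫ u dπ_α − 2C_p·∫ β dπ_α ≥ b`. -/
theorem mixture_policy_feasibility_bandit
    {A : Type*} [MeasurableSpace A]
    (ξ Cp b : ℝ) (hξ : 0 < ξ) (hCp : 0 < Cp)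
    (πsf πstar : Measure A) [IsProbabilityMeasure πsf] [IsProbabilityMeasure πstar]
    (u β : A → ℝ) (hu_meas : Measurable u) (hβ_meas : Measurable β)
    (hu_bdd : ∃ C, ∀ a, |u a| ≤ C) (hβ_bdd : ∃ C, ∀ a, β a ≤ C)
    (hβ_nonneg : ∀ a, 0 ≤ β a)
    (h_safe : (∫ a, u a ∂πsf) - b ≥ ξ)
    (h_star : (∫ a, u a ∂πstar) ≥ b)
    (h_conf : 2 * Cp * (∫ a, β a ∂πsf) ≤ ξ)
    (h_den : 0 < ξ - 2 * Cp * (∫ a, β a ∂πsf) + 2 * Cp * (∫ a, β a ∂πstar))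
    (α : ℝ)
    (hα : α ∈ Set.Icc 0 ((ξ - 2 * Cp * (∫ a, β a ∂πsf)) /
        (ξ - 2 * Cp * (∫ a, β a ∂πsf) + 2 * Cp * (∫ a, β a ∂πstar)))) :
    (∫ a, u a ∂(ENNReal.ofReal (1 - α) • πsf + ENNReal.ofReal α • πstar))
      - 2 * Cp * (∫ a, β a ∂(ENNReal.ofReal (1 - α) • πsf + ENNReal.ofReal α • πstar)) ≥ b := by
  obtain ⟨h0, hle⟩ := hα
  have hβ_int : 0 ≤ 2 * Cp * ∫ a, β a ∂πstar :=
    mul_nonneg (by positivity) (integral_nonneg hβ_nonneg)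
  have h1 : α ≤ 1 := hle.trans (div_le_one_of_le₀ (by linarith) h_den.le)
  have hβ_abs : ∃ C, ∀ a, |β a| ≤ C :=
    hβ_bdd.imp fun C hC a => (abs_of_nonneg (hβ_nonneg a)).trans_le (hC a)
  rw [integral_mixture_of_bounded πsf πstar hu_meas hu_bdd h0 h1,
    integral_mixture_of_bounded πsf πstar hβ_meas hβ_abs h0 h1]
  rw [le_div_iff₀ h_den] at hle
  have hsafe := mul_le_mul_of_nonneg_left h_safe (sub_nonneg.2 h1)
  have hstar := mul_le_mul_of_nonneg_left h_star h0
  linarith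
end

section
/- Mixture policy optimism (bandit). Let ξ > 0, C_p > 0, B > 0. Let π_sf and π_⋆ be probability measures on A and write r_sf = ∫r dπ_sf, r_⋆ = ∫r dπ_⋆, β_sf = ∫β dπ_sf, β_⋆ = ∫β dπ_⋆. Assume r_sf ≥ 0, r_⋆ ≤ B, 2·C_p·β_sf ≤ ξ, and ξ − 2C_p·β_sf + 2C_p·β_⋆ > 0. Set α̂ = (ξ − 2C_p·β_sf)/(ξ − 2C_p·β_sf + 2C_p·β_⋆) and π_α̂ = (1−α̂)·π_sf + α̂·π_⋆. Then ∫r dπ_α̂ + (2B·C_p/ξ)·∫β dπ_α̂ ≥ r_⋆. -/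
open MeasureTheory

/-- Integral against a mixture of two measures with nonnegative weights. -/
theorem integral_ofReal_smul_add_ofReal_smul {A : Type*} [MeasurableSpace A]
    {μ ν : Measure A} {f : A → ℝ} (hμ : Integrable f μ) (hν : Integrable f ν)
    {a b : ℝ} (ha : 0 ≤ a) (hb : 0 ≤ b) :
    ∫ x, f x ∂(ENNReal.ofReal a • μ + ENNReal.ofReal b • ν)
      = a * ∫ x, f x ∂μ + b * ∫ x, f x ∂ν := by
  rw [integral_add_measure (hμ.smul_measure ENNReal.ofReal_ne_top)
    (hν.smul_measure ENNReal.ofReal_ne_top), integral_smul_measure, integral_smul_measure,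
    ENNReal.toReal_ofReal ha, ENNReal.toReal_ofReal hb, smul_eq_mul, smul_eq_mul]

/-- **Mixture policy optimism (bandit).**
With `α̂ = (ξ − 2C_p·β_sf)/(ξ − 2C_p·β_sf + 2C_p·β_⋆)` and the mixture measure
`π_α̂ = (1−α̂)·π_sf + α̂·π_⋆`, we have `∫ r dπ_α̂ + (2B·C_p/ξ)·∫ β dπ_α̂ ≥ r_⋆`. -/
theorem mixture_policy_optimism_bandit
    {A : Type*} [MeasurableSpace A]
    (ξ Cp B : ℝ) (hξ : 0 < ξ) (hCp : 0 < Cp) (hB : 0 < B)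
    (πsf πstar : Measure A) [IsProbabilityMeasure πsf] [IsProbabilityMeasure πstar]
    (r β : A → ℝ) (hr_meas : Measurable r) (hβ_meas : Measurable β)
    (hr_bdd : ∃ C, ∀ a, |r a| ≤ C) (hβ_bdd : ∃ C, ∀ a, β a ≤ C)
    (hβ_nonneg : ∀ a, 0 ≤ β a)
    (h_rsf : (∫ a, r a ∂πsf) ≥ 0)
    (h_rstar : (∫ a, r a ∂πstar) ≤ B)
    (h_conf : 2 * Cp * (∫ a, β a ∂πsf) ≤ ξ)
    (h_den : 0 < ξ - 2 * Cp * (∫ a, β a ∂πsf) + 2 * Cp * (∫ a, β a ∂πstar)) :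
    (∫ a, r a ∂(ENNReal.ofReal
          (1 - (ξ - 2 * Cp * (∫ a, β a ∂πsf)) /
            (ξ - 2 * Cp * (∫ a, β a ∂πsf) + 2 * Cp * (∫ a, β a ∂πstar))) • πsf
        + ENNReal.ofReal
          ((ξ - 2 * Cp * (∫ a, β a ∂πsf)) /
            (ξ - 2 * Cp * (∫ a, β a ∂πsf) + 2 * Cp * (∫ a, β a ∂πstar))) • πstar))
      + (2 * B * Cp / ξ) *
        (∫ a, β a ∂(ENNReal.ofReal
          (1 - (ξ - 2 * Cp * (∫ a, β a ∂πsf)) /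
            (ξ - 2 * Cp * (∫ a, β a ∂πsf) + 2 * Cp * (∫ a, β a ∂πstar))) • πsf
        + ENNReal.ofReal
          ((ξ - 2 * Cp * (∫ a, β a ∂πsf)) /
            (ξ - 2 * Cp * (∫ a, β a ∂πsf) + 2 * Cp * (∫ a, β a ∂πstar))) • πstar))
      ≥ ∫ a, r a ∂πstar := by
  obtain ⟨C, hC⟩ := hr_bdd
  obtain ⟨D, hD⟩ := hβ_bdd
  have hr_int (μ : Measure A) [IsProbabilityMeasure μ] : Integrable r μ :=
    .of_bound hr_meas.aestronglyMeasurable C (.of_forall hC)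
  have hβ_int (μ : Measure A) [IsProbabilityMeasure μ] : Integrable β μ :=
    .of_bound hβ_meas.aestronglyMeasurable D
      (.of_forall fun a => by rw [Real.norm_of_nonneg (hβ_nonneg a)]; exact hD a)
  have hβstar : 0 ≤ ∫ a, β a ∂πstar := integral_nonneg hβ_nonneg
  set bsf := ∫ a, β a ∂πsf
  set bstar := ∫ a, β a ∂πstar
  set α := (ξ - 2 * Cp * bsf) / (ξ - 2 * Cp * bsf + 2 * Cp * bstar) with hα
  have hα0 : 0 ≤ α := div_nonneg (by linarith) h_den.le
  have hα1 : 0 ≤ 1 - α := by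
    rw [sub_nonneg, hα, div_le_one h_den]
    linarith [mul_nonneg hCp.le hβstar]
  rw [integral_ofReal_smul_add_ofReal_smul (hr_int πsf) (hr_int πstar) hα1 hα0,
    integral_ofReal_smul_add_ofReal_smul (hβ_int πsf) (hβ_int πstar) hα1 hα0]
  have hbonus : 2 * B * Cp / ξ * ((1 - α) * bsf + α * bstar) = B * (1 - α) := by
    have hne := h_den.ne'
    rw [hα]
    field_simp
    ring
  change _ + 2 * B * Cp / ξ * ((1 - α) * bsf + α * bstar) ≥ _
  rw [hbonus]
  nlinarith [mul_nonneg hα1 h_rsf, mul_nonneg hα1 (sub_nonneg.2 h_rstar)]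
end

section
/- Logarithmic bound on the number of unconfident iterations (bandit). Let K ≥ 1, d ≥ 1, δ ∈ (0,1], ξ > 0, C_p > 0. Let a^(1),…,a^(K) ∈ ℝ^d with ‖a^(k)‖₂ ≤ 1 for all k, and set Λ^(k) = I_d + Σ_{i<k} a^(i)·(a^(i))ᵀ. Let π_sf, π^(1),…,π^(K) be probability measures on {a ∈ ℝ^d : ‖a‖₂ ≤ 1}, and define U = {k ∈ {1,…,K} : ∫‖a‖_{(Λ^(k))⁻¹} dπ_sf(a) > ξ/(2C_p)}. Assume π^(k) = π_sf for every k ∈ U, and assume the inequality Σ_{k=1}^K ∫‖a‖²_{(Λ^(k))⁻¹} dπ^(k)(a) ≤ 2·Σ_{k=1}^K ‖a^(k)‖²_{(Λ^(k))⁻¹} + 4·ln(2K/δ). Then |U| ≤ 32·d·C_p²·ξ⁻²·ln(2K/δ). -/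
open MeasureTheory Matrix Finset
open scoped Classical

/-- The regularized Gram matrix `I + ∑ i ∈ s, aᵢ aᵢᵀ` is positive definite. -/
lemma posDef_one_add_sum_vecMulVec {n ι : Type*} [Fintype n] [DecidableEq n]
    (s : Finset ι) (a : ι → n → ℝ) :
    (1 + ∑ i ∈ s, vecMulVec (a i) (a i)).PosDef :=
  PosDef.one.add_posSemidef (posSemidef_sum s fun i _ => by
    simpa using posSemidef_vecMulVec_self_star (a i))

/-- If `M` is positive semidefinite, then the quadratic form of `(1 + M)⁻¹` is at most that of the
identity. -/
lemma dotProduct_inv_one_add_mulVec_le {n : Type*} [Fintype n] [DecidableEq n]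
    {M : Matrix n n ℝ} (hM : M.PosSemidef) (x : n → ℝ) :
    x ⬝ᵥ (1 + M)⁻¹ *ᵥ x ≤ x ⬝ᵥ x := by
  have hdet : IsUnit (1 + M).det := (PosDef.one.add_posSemidef hM).det_pos.ne'.isUnit
  set y := (1 + M)⁻¹ *ᵥ x with hy
  have hx : x = y + M *ᵥ y := by
    calc x = (1 + M) *ᵥ y := by rw [hy, mulVec_mulVec, mul_nonsing_inv _ hdet, one_mulVec]
      _ = y + M *ᵥ y := by rw [add_mulVec, one_mulVec]
  have hMy : 0 ≤ y ⬝ᵥ M *ᵥ y := by simpa using hM.dotProduct_mulVec_nonneg y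
  have hMM : 0 ≤ (M *ᵥ y) ⬝ᵥ (M *ᵥ y) := by simpa using dotProduct_self_star_nonneg (M *ᵥ y)
  have hcomm : (M *ᵥ y) ⬝ᵥ y = y ⬝ᵥ M *ᵥ y := dotProduct_comm _ _
  rw [hx]
  simp only [add_dotProduct, dotProduct_add]
  linarith

/-- The matrix determinant lemma for a symmetric rank-one update. -/
lemma det_add_vecMulVec_self {n : Type*} [Fintype n] [DecidableEq n]
    {A : Matrix n n ℝ} (hA : IsUnit A.det) (x : n → ℝ) :
    (A + vecMulVec x x).det = A.det * (1 + x ⬝ᵥ A⁻¹ *ᵥ x) := by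
  rw [vecMulVec_eq Unit, det_add_replicateCol_mul_replicateRow hA, det_unique (n := Unit),
    Matrix.add_apply, one_apply_eq, Matrix.mul_assoc]
  rfl

/-- The tangent-line bound on the log-determinant of a positive definite matrix. -/
lemma Matrix.PosDef.log_det_le {n : Type*} [Fintype n] [DecidableEq n]
    {A : Matrix n n ℝ} (hA : A.PosDef) {c : ℝ} (hc : 0 < c) :
    Real.log A.det ≤ A.trace / c - Fintype.card n + Fintype.card n * Real.log c := by
  have hpos := hA.eigenvalues_pos
  rw [hA.1.det_eq_prod_eigenvalues, hA.1.trace_eq_sum_eigenvalues]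
  simp only [RCLike.ofReal_real_eq_id, id]
  rw [Real.log_prod fun i _ => (hpos i).ne', Finset.sum_div]
  calc ∑ i, Real.log (hA.1.eigenvalues i)
      ≤ ∑ i, (hA.1.eigenvalues i / c - 1 + Real.log c) := by
        refine Finset.sum_le_sum fun i _ => ?_
        have h := Real.log_le_sub_one_of_pos (div_pos (hpos i) hc)
        rw [Real.log_div (hpos i).ne' hc.ne'] at h
        linarith
    _ = _ := by simp [Finset.sum_add_distrib, Finset.sum_sub_distrib]

/-- The elliptical potential lemma, in terms of the log-determinant. -/
lemma sum_dotProduct_inv_mulVec_le_log_det {n : Type*} [Fintype n] [DecidableEq n]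
    (a : ℕ → n → ℝ) (Λ : ℕ → Matrix n n ℝ)
    (hΛ : ∀ k, Λ k = 1 + ∑ i ∈ Finset.Ico 1 k, vecMulVec (a i) (a i))
    (K : ℕ) (ha : ∀ k ∈ Finset.Icc 1 K, a k ⬝ᵥ a k ≤ 1) :
    ∑ k ∈ Finset.Icc 1 K, (a k ⬝ᵥ (Λ k)⁻¹ *ᵥ a k) ≤ 2 * Real.log (Λ (K + 1)).det := by
  have hpos : ∀ k, (Λ k).PosDef := fun k => hΛ k ▸ posDef_one_add_sum_vecMulVec _ a
  induction K with
  | zero => simp [hΛ]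
  | succ m ih =>
    have hm := ih fun k hk => ha k (Finset.Icc_subset_Icc_right m.le_succ hk)
    rw [Finset.sum_Icc_succ_top (by simp)]
    set w := a (m + 1) ⬝ᵥ (Λ (m + 1))⁻¹ *ᵥ a (m + 1) with hw
    have hw0 : 0 ≤ w := by
      simpa using (hpos (m + 1)).inv.posSemidef.dotProduct_mulVec_nonneg (a (m + 1))
    have hw1 : w ≤ 1 := by
      refine le_trans ?_ (ha (m + 1) (by simp))
      rw [hw, hΛ]
      exact dotProduct_inv_one_add_mulVec_le (posSemidef_sum _ fun i _ => by
        simpa using posSemidef_vecMulVec_self_star (a i)) _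
    have hstep : Λ (m + 1 + 1) = Λ (m + 1) + vecMulVec (a (m + 1)) (a (m + 1)) := by
      rw [hΛ, hΛ (m + 1), Finset.sum_Ico_succ_top (by simp), add_assoc]
    have hdet := (hpos (m + 1)).det_pos
    rw [hstep, det_add_vecMulVec_self hdet.ne'.isUnit, ← hw,
      Real.log_mul hdet.ne' (by positivity)]
    have hlog := Real.le_log_one_add_of_nonneg hw0
    have hfrac : w / 2 ≤ 2 * w / (w + 2) := by
      rw [div_le_div_iff₀ two_pos (by positivity)]
      nlinarith
    linarith

/-- The elliptical potential lemma for vectors in the Euclidean unit ball. -/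
lemma sum_dotProduct_inv_mulVec_le {n : Type*} [Fintype n] [DecidableEq n] [Nonempty n]
    (a : ℕ → n → ℝ) (Λ : ℕ → Matrix n n ℝ)
    (hΛ : ∀ k, Λ k = 1 + ∑ i ∈ Finset.Ico 1 k, vecMulVec (a i) (a i))
    (K : ℕ) (ha : ∀ k ∈ Finset.Icc 1 K, a k ⬝ᵥ a k ≤ 1) :
    ∑ k ∈ Finset.Icc 1 K, (a k ⬝ᵥ (Λ k)⁻¹ *ᵥ a k)
      ≤ 2 * (Fintype.card n * Real.log (1 + K)) := by
  have hn : (1 : ℝ) ≤ Fintype.card n := by exact_mod_cast Fintype.card_pos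
  have hpos : (Λ (K + 1)).PosDef := hΛ (K + 1) ▸ posDef_one_add_sum_vecMulVec _ a
  have hc : (0 : ℝ) < 1 + K := by positivity
  have htrace : (Λ (K + 1)).trace ≤ Fintype.card n + K := by
    rw [hΛ, trace_add, trace_one, trace_sum]
    gcongr
    have h := Finset.sum_le_card_nsmul (Finset.Ico 1 (K + 1))
      (fun i => (vecMulVec (a i) (a i)).trace) 1 fun i hi => by
        simpa [trace_vecMulVec] using ha i (by simp at hi ⊢; lia)
    simpa using h
  have hdiv : (Λ (K + 1)).trace / (1 + K) ≤ Fintype.card n := by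
    rw [div_le_iff₀ hc]
    nlinarith [(Nat.cast_nonneg K : (0 : ℝ) ≤ K)]
  have := hpos.log_det_le hc
  have := sum_dotProduct_inv_mulVec_le_log_det a Λ hΛ K ha
  linarith

/-- The Euclidean unit ball of `n → ℝ` is compact. -/
lemma isCompact_setOf_sqrt_sum_sq_le_one {n : Type*} [Fintype n] :
    IsCompact {x : n → ℝ | Real.sqrt (∑ i, x i ^ 2) ≤ 1} := by
  refine (isCompact_closedBall (0 : n → ℝ) 1).of_isClosed_subset
    (isClosed_le (by fun_prop) continuous_const) fun x hx => ?_
  rw [mem_closedBall_zero_iff, pi_norm_le_iff_of_nonneg zero_le_one]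
  intro i
  refine le_trans ?_ (Set.mem_ofPred.1 hx)
  rw [Real.norm_eq_abs]
  exact Real.abs_le_sqrt (Finset.single_le_sum (f := fun i => x i ^ 2)
    (fun j _ => sq_nonneg (x j)) (Finset.mem_univ i))

/-- A continuous function is integrable against a probability measure carried by a compact set. -/
lemma Continuous.integrable_of_isCompact_of_measure_eq_one {X : Type*} [TopologicalSpace X]
    [T2Space X] [MeasurableSpace X] [OpensMeasurableSpace X] {μ : Measure X}
    [IsProbabilityMeasure μ] {s : Set X} (hs : IsCompact s) (hμ : μ s = 1) {f : X → ℝ}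
    (hf : Continuous f) : Integrable f μ := by
  have h : IntegrableOn f s μ :=
    hf.continuousOn.integrableOn_of_subset_isCompact hs hs.measurableSet subset_rfl
      (measure_ne_top μ s)
  rwa [IntegrableOn, Measure.restrict_eq_self_of_ae_mem
    ((mem_ae_iff_prob_eq_one hs.measurableSet).2 hμ)] at h

/-- Jensen's inequality for the square root, in threshold form. -/
lemma sq_le_integral_of_le_integral_sqrt {X : Type*} [MeasurableSpace X] {μ : Measure X}
    [IsProbabilityMeasure μ] {f : X → ℝ} (hf0 : ∀ x, 0 ≤ f x) (hf : Integrable f μ)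
    (hsqrt : Integrable (fun x => Real.sqrt (f x)) μ) {t : ℝ} (ht0 : 0 ≤ t)
    (ht : t ≤ ∫ x, Real.sqrt (f x) ∂μ) : t ^ 2 ≤ ∫ x, f x ∂μ := by
  have h : ∫ x, (2 * t * Real.sqrt (f x) - t ^ 2) ∂μ ≤ ∫ x, f x ∂μ := by
    refine integral_mono ((hsqrt.const_mul _).sub (integrable_const _)) hf fun x => ?_
    dsimp only
    nlinarith [sq_nonneg (Real.sqrt (f x) - t), Real.sq_sqrt (hf0 x)]
  rw [integral_sub (hsqrt.const_mul _) (integrable_const _), integral_const_mul] at h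
  simp only [integral_const, probReal_univ, one_smul] at h
  nlinarith [mul_le_mul_of_nonneg_left ht ht0]

/-- **Logarithmic bound on the number of unconfident iterations (bandit).**
With `Λ^(k) = I + Σ_{i<k} a^(i)(a^(i))ᵀ`, `U` the set of rounds where the expected bonus of the
safe policy exceeds `ξ/(2C_p)`, assuming the safe policy is played on every round of `U` and the
good-event inequality relating expected to realized squared bonuses, we get
`|U| ≤ 32·d·C_p²·ξ⁻²·ln(2K/δ)`. -/
theorem log_bound_unconfident_iterations_bandit
    (K d : ℕ) (hK : 1 ≤ K) (hd : 1 ≤ d)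
    (δ ξ Cp : ℝ) (hδ : δ ∈ Set.Ioc (0:ℝ) 1) (hξ : 0 < ξ) (hCp : 0 < Cp)
    (a : ℕ → Fin d → ℝ)
    (ha : ∀ k ∈ Finset.Icc 1 K, Real.sqrt (∑ i, a k i ^ 2) ≤ 1)
    (Λ : ℕ → Matrix (Fin d) (Fin d) ℝ)
    (hΛ : ∀ k, Λ k = 1 + ∑ i ∈ Finset.Ico 1 k, vecMulVec (a i) (a i))
    (πsf : Measure (Fin d → ℝ)) [IsProbabilityMeasure πsf]
    (hπsf_supp : πsf {x | Real.sqrt (∑ i, x i ^ 2) ≤ 1} = 1)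
    (π : ℕ → Measure (Fin d → ℝ)) (hπ_prob : ∀ k ∈ Finset.Icc 1 K, IsProbabilityMeasure (π k))
    (hπ_supp : ∀ k ∈ Finset.Icc 1 K, π k {x | Real.sqrt (∑ i, x i ^ 2) ≤ 1} = 1)
    (U : Finset ℕ)
    (hU : U = (Finset.Icc 1 K).filter
      (fun k => ξ / (2 * Cp) < ∫ x, Real.sqrt (x ⬝ᵥ (Λ k)⁻¹.mulVec x) ∂πsf))
    (hdeploy : ∀ k ∈ U, π k = πsf)
    (hgood : ∑ k ∈ Finset.Icc 1 K, (∫ x, x ⬝ᵥ (Λ k)⁻¹.mulVec x ∂(π k))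
      ≤ 2 * ∑ k ∈ Finset.Icc 1 K, (a k ⬝ᵥ (Λ k)⁻¹.mulVec (a k))
        + 4 * Real.log (2 * K / δ)) :
    (U.card : ℝ) ≤ 32 * d * Cp ^ 2 * ξ⁻¹ ^ 2 * Real.log (2 * K / δ) := by
  have : Nonempty (Fin d) := ⟨⟨0, hd⟩⟩
  have hpos : ∀ k, (Λ k)⁻¹.PosSemidef := fun k =>
    (hΛ k ▸ posDef_one_add_sum_vecMulVec _ a : (Λ k).PosDef).inv.posSemidef
  have hquad : ∀ k x, 0 ≤ x ⬝ᵥ (Λ k)⁻¹ *ᵥ x := fun k x => by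
    simpa using (hpos k).dotProduct_mulVec_nonneg x
  have hcont : ∀ k, Continuous fun x : Fin d → ℝ => x ⬝ᵥ (Λ k)⁻¹ *ᵥ x := fun k => by
    fun_prop
  have ha' : ∀ k ∈ Finset.Icc 1 K, a k ⬝ᵥ a k ≤ 1 := fun k hk => by
    simpa [dotProduct, sq] using Real.sqrt_le_one.1 (ha k hk)
  have hpotential := sum_dotProduct_inv_mulVec_le a Λ hΛ K ha'
  rw [Fintype.card_fin] at hpotential
  have hUK : U ⊆ Finset.Icc 1 K := hU ▸ Finset.filter_subset _ _
  have hbonus : ∀ k ∈ U, (ξ / (2 * Cp)) ^ 2 ≤ ∫ x, x ⬝ᵥ (Λ k)⁻¹ *ᵥ x ∂(π k) := by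
    intro k hk
    rw [hdeploy k hk]
    rw [hU, Finset.mem_filter] at hk
    exact sq_le_integral_of_le_integral_sqrt (hquad k)
      ((hcont k).integrable_of_isCompact_of_measure_eq_one isCompact_setOf_sqrt_sum_sq_le_one
        hπsf_supp)
      ((hcont k).sqrt.integrable_of_isCompact_of_measure_eq_one
        isCompact_setOf_sqrt_sum_sq_le_one hπsf_supp)
      (by positivity) hk.2.le
  have hcard : U.card * (ξ / (2 * Cp)) ^ 2
      ≤ ∑ k ∈ Finset.Icc 1 K, ∫ x, x ⬝ᵥ (Λ k)⁻¹ *ᵥ x ∂(π k) := by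
    rw [← nsmul_eq_mul]
    exact (Finset.card_nsmul_le_sum U _ _ hbonus).trans
      (Finset.sum_le_sum_of_subset_of_nonneg hUK fun k _ _ => integral_nonneg (hquad k))
  have hK' : (1 : ℝ) ≤ K := by exact_mod_cast hK
  have hd' : (1 : ℝ) ≤ d := by exact_mod_cast hd
  have harg : 1 + (K : ℝ) ≤ 2 * K / δ := by
    rw [le_div_iff₀ hδ.1]
    nlinarith [hδ.2]
  have hlog : Real.log (1 + K) ≤ Real.log (2 * K / δ) := Real.log_le_log (by positivity) harg
  have hlog0 : 0 ≤ Real.log (2 * K / δ) := Real.log_nonneg (by linarith)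
  have hmain : U.card * (ξ / (2 * Cp)) ^ 2 ≤ 8 * (d * Real.log (2 * K / δ)) := by
    have h1 : d * Real.log (1 + K) ≤ d * Real.log (2 * K / δ) := by gcongr
    have h2 := mul_le_mul_of_nonneg_right hd' hlog0
    linarith
  calc (U.card : ℝ) = U.card * (ξ / (2 * Cp)) ^ 2 * (4 * Cp ^ 2 * ξ⁻¹ ^ 2) := by
        field_simp; norm_num
    _ ≤ 8 * (d * Real.log (2 * K / δ)) * (4 * Cp ^ 2 * ξ⁻¹ ^ 2) := by gcongr
    _ = _ := by ring
end

section
/- Regularized value difference lemma. Let κ ≥ 0, let π̃ and π be two policies, let g: {1,…,H}×S×A → ℝ be a reward function, and let Q̃_h: S×A → ℝ be arbitrary functions for h ∈ {1,…,H}. Define Ṽ_h(s) = Σ_a π̃_h(a|s)·(Q̃_h(s,a) − κ·ln π̃_h(a|s)) for h ∈ {1,…,H} and Ṽ_{H+1} = 0. Then for every h ∈ {1,…,H} and s ∈ S: Ṽ_h(s) − V^{π,g}_{P,h}[κ](s) = V^{π,f¹}_{P,h}(s) + V^{π,f²}_{P,h}(s), where f¹_h(s,a) = Σ_{a'} [ π̃_h(a'|s)·(Q̃_h(s,a')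 − κ·ln π̃_h(a'|s)) − π_h(a'|s)·(Q̃_h(s,a') − κ·ln π_h(a'|s)) ] (a function of (h,s) only, constant in a) and f²_h(s,a) = Q̃_h(s,a) − g_h(s,a) − Σ_{s'} P_h(s'|s,a)·Ṽ_{h+1}(s'). -/
/-- Entropy-regularized value function of policy `pol` for reward `g`, by backward recursion:
`Vaux P pol g κ n h s` is the value at step `h`, state `s`, with `n` steps remaining
(so the value at step `h` of a horizon-`H` MDP is `Vaux P pol g κ (H + 1 - h) h s`). -/
noncomputable def Vaux {S A : Type*} [Fintype S] [Fintype A]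
    (P : ℕ → S → A → S → ℝ) (pol : ℕ → S → A → ℝ) (g : ℕ → S → A → ℝ) (κ : ℝ) :
    ℕ → ℕ → S → ℝ
  | 0, _, _ => 0
  | n + 1, h, s => ∑ a, pol h s a *
      ((g h s a + ∑ s', P h s a s' * Vaux P pol g κ n (h + 1) s')
        - κ * Real.log (pol h s a))

/-- `Vval H P pol g κ h s = V^{pol,g}_{P,h}[κ](s)` for a horizon-`H` MDP
(with `Vval H P pol g κ (H+1) = 0`). -/
noncomputable def Vval {S A : Type*} [Fintype S] [Fintype A] (H : ℕ)
    (P : ℕ → S → A → S → ℝ) (pol : ℕ → S → A → ℝ) (g : ℕ → S → A → ℝ) (κ : ℝ)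
    (h : ℕ) (s : S) : ℝ :=
  Vaux P pol g κ (H + 1 - h) h s

/-- The value difference identity, by induction on the number `n` of remaining steps. -/
theorem sub_Vaux_eq_Vaux_add_Vaux {S A : Type*} [Fintype S] [Fintype A]
    (H : ℕ) (P : ℕ → S → A → S → ℝ) (κ : ℝ) (πt π : ℕ → S → A → ℝ)
    (hπ : ∀ h s, ∑ a, π h s a = 1)
    (g Qt : ℕ → S → A → ℝ) (Vt : ℕ → S → ℝ)
    (hVt : ∀ h ∈ Finset.Icc 1 H, ∀ s : S,
      Vt h s = ∑ a, πt h s a * (Qt h s a - κ * Real.log (πt h s a)))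
    (hVtTop : ∀ s : S, Vt (H + 1) s = 0)
    (n h : ℕ) (hpos : 1 ≤ h) (hn : h + n = H + 1) (s : S) :
    Vt h s - Vaux P π g κ n h s =
      Vaux P π
        (fun h' s' _ =>
          (∑ a', πt h' s' a' * (Qt h' s' a' - κ * Real.log (πt h' s' a')))
            - (∑ a', π h' s' a' * (Qt h' s' a' - κ * Real.log (π h' s' a')))) 0 n h s
      + Vaux P π
          (fun h' s' a' => Qt h' s' a' - g h' s' a'
            - ∑ s'', P h' s' a' s'' * Vt (h' + 1) s'') 0 n h s := by
  induction n generalizing h s with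
  | zero =>
    obtain rfl : h = H + 1 := by omega
    simp [Vaux, hVtTop]
  | succ n ih =>
    have ih' := fun s' => ih (h + 1) (by omega) (by omega) s'
    have hV := hVt h (Finset.mem_Icc.2 ⟨hpos, by omega⟩) s
    simp only [Vaux]
    rw [← hV]
    set V₁ := Vaux P π (fun h' s' _ =>
      (∑ a', πt h' s' a' * (Qt h' s' a' - κ * Real.log (πt h' s' a')))
        - (∑ a', π h' s' a' * (Qt h' s' a' - κ * Real.log (π h' s' a')))) 0 n (h + 1)
    set V₂ := Vaux P π (fun h' s' a' => Qt h' s' a' - g h' s' a'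
      - ∑ s'', P h' s' a' s'' * Vt (h' + 1) s'') 0 n (h + 1)
    have hP : ∀ a, ∑ s', P h s a s' * V₂ s' = ∑ s', P h s a s' * Vt (h + 1) s'
        - ∑ s', P h s a s' * Vaux P π g κ n (h + 1) s' - ∑ s', P h s a s' * V₁ s' := by
      intro a
      rw [← Finset.sum_sub_distrib, ← Finset.sum_sub_distrib]
      refine Finset.sum_congr rfl fun s' _ => ?_
      linear_combination - P h s a s' * ih' s'
    have hone : Vt h s = ∑ a, π h s a * Vt h s := by
      rw [← Finset.sum_mul, hπ, one_mul]
    have hmean : ∑ a', π h s a' * (Qt h s a' - κ * Real.log (π h s a')) =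
        ∑ a, π h s a * ∑ a', π h s a' * (Qt h s a' - κ * Real.log (π h s a')) := by
      rw [← Finset.sum_mul, hπ, one_mul]
    simp only [hP, zero_mul, sub_zero]
    rw [← Finset.sum_add_distrib, sub_eq_iff_eq_add, ← Finset.sum_add_distrib]
    set M := ∑ a', π h s a' * (Qt h s a' - κ * Real.log (π h s a')) with hM
    calc Vt h s = ∑ a, π h s a * Vt h s - ∑ a, π h s a * M + M := by
          rw [← hone, ← hmean]; ring
      _ = _ := by
        nth_rewrite 2 [hM]
        rw [← Finset.sum_sub_distrib, ← Finset.sum_add_distrib]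
        exact Finset.sum_congr rfl fun a _ => by ring

/-- **Regularized value difference lemma.**
For arbitrary functions `Q̃_h` and the associated `Ṽ_h` (defined on steps `1..H` with
`Ṽ_{H+1} = 0`), for every `h ∈ {1,…,H}` and state `s`:
`Ṽ_h(s) − V^{π,g}_{P,h}[κ](s) = V^{π,f¹}_{P,h}(s) + V^{π,f²}_{P,h}(s)`, where
`f¹_h(s,a) = Σ_{a'} [π̃_h(a'|s)(Q̃_h(s,a') − κ ln π̃_h(a'|s)) − π_h(a'|s)(Q̃_h(s,a') − κ ln π_h(a'|s))]`
and `f²_h(s,a) = Q̃_h(s,a) − g_h(s,a) − Σ_{s'} P_h(s'|s,a)·Ṽ_{h+1}(s')`. -/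
theorem regularized_value_difference
    {S A : Type*} [Fintype S] [Fintype A]
    (H : ℕ) (hH : 1 ≤ H)
    (P : ℕ → S → A → S → ℝ)
    (hP : ∀ h s a, (∀ s', 0 ≤ P h s a s') ∧ ∑ s', P h s a s' = 1)
    (κ : ℝ) (hκ : 0 ≤ κ)
    (πt π : ℕ → S → A → ℝ)
    (hπt : ∀ h s, (∀ a, 0 ≤ πt h s a) ∧ ∑ a, πt h s a = 1)
    (hπ : ∀ h s, (∀ a, 0 ≤ π h s a) ∧ ∑ a, π h s a = 1)
    (g Qt : ℕ → S → A → ℝ) (Vt : ℕ → S → ℝ)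
    (hVt : ∀ h ∈ Finset.Icc 1 H, ∀ s : S,
      Vt h s = ∑ a, πt h s a * (Qt h s a - κ * Real.log (πt h s a)))
    (hVtTop : ∀ s : S, Vt (H + 1) s = 0)
    (h : ℕ) (hh : h ∈ Finset.Icc 1 H) (s : S) :
    Vt h s - Vval H P π g κ h s =
      Vval H P π
        (fun h' s' _ =>
          (∑ a', πt h' s' a' * (Qt h' s' a' - κ * Real.log (πt h' s' a')))
            - (∑ a', π h' s' a' * (Qt h' s' a' - κ * Real.log (π h' s' a')))) 0 h s
      + Vval H P π
          (fun h' s' a' => Qt h' s' a' - g h' s' a'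
            - ∑ s'', P h' s' a' s'' * Vt (h' + 1) s'') 0 h s := by
  have hh' := Finset.mem_Icc.1 hh
  exact sub_Vaux_eq_Vaux_add_Vaux H P κ πt π (fun h s => (hπ h s).2) g Qt Vt hVt hVtTop
    (H + 1 - h) h hh'.1 (by omega) s
end

section
/- L1 Lipschitz property of softmax policies. Let A be a finite nonempty set, let Q, Q̃: A → ℝ, and let κ > 0. Then Σ_{a∈A} | softmax(Q/κ)(a) − softmax(Q̃/κ)(a) | ≤ (8/κ)·max_{a∈A} |Q(a) − Q̃(a)|. -/
/-- If `x` and `y` differ by at most `d` everywhere, passing from `softmax x` to `softmax y` loses at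
most a fraction `2 * d` of the mass at each point. -/
theorem softmax_sub_le_two_mul {A : Type*} [Fintype A] {x y : A → ℝ} {d : ℝ}
    (h : ∀ a, |x a - y a| ≤ d) (a : A) :
    Real.exp (x a) / (∑ a', Real.exp (x a')) - Real.exp (y a) / (∑ a', Real.exp (y a'))
      ≤ 2 * d * (Real.exp (x a) / (∑ a', Real.exp (x a'))) := by
  have : Nonempty A := ⟨a⟩
  have hx : 0 < ∑ a', Real.exp (x a') :=
    Finset.sum_pos (fun _ _ => Real.exp_pos _) Finset.univ_nonempty
  have hy : 0 < ∑ a', Real.exp (y a') :=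
    Finset.sum_pos (fun _ _ => Real.exp_pos _) Finset.univ_nonempty
  have hnum : Real.exp (-d) * Real.exp (x a) ≤ Real.exp (y a) := by
    rw [← Real.exp_add]
    exact Real.exp_le_exp.2 (by linarith [(abs_le.1 (h a)).2])
  have hden : ∑ a', Real.exp (y a') ≤ Real.exp d * ∑ a', Real.exp (x a') := by
    rw [Finset.mul_sum]
    refine Finset.sum_le_sum fun b _ => ?_
    rw [← Real.exp_add]
    exact Real.exp_le_exp.2 (by linarith [(abs_le.1 (h b)).1])
  have hexp : Real.exp (-(2 * d)) * (Real.exp (x a) / ∑ a', Real.exp (x a'))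
      ≤ Real.exp (y a) / ∑ a', Real.exp (y a') := calc
    _ = Real.exp (-d) * Real.exp (x a) / (Real.exp d * ∑ a', Real.exp (x a')) := by
      rw [two_mul, neg_add, Real.exp_add, Real.exp_neg]
      field_simp
    _ ≤ _ := div_le_div₀ (Real.exp_pos _).le hnum hy hden
  have hp : 0 ≤ Real.exp (x a) / ∑ a', Real.exp (x a') := by positivity
  nlinarith [mul_le_mul_of_nonneg_right (Real.add_one_le_exp (-(2 * d))) hp]

theorem sum_softmax_eq_one {A : Type*} [Fintype A] [Nonempty A] (x : A → ℝ) :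
    ∑ a, Real.exp (x a) / (∑ a', Real.exp (x a')) = 1 := by
  rw [← Finset.sum_div]
  exact div_self (Finset.sum_pos (fun _ _ => Real.exp_pos _) Finset.univ_nonempty).ne'

/-- If `x` and `y` differ by at most `d` everywhere, their softmax distributions are at `L¹` distance
at most `4 * d`. -/
theorem sum_abs_softmax_sub_le {A : Type*} [Fintype A] [Nonempty A] {x y : A → ℝ} {d : ℝ}
    (h : ∀ a, |x a - y a| ≤ d) :
    ∑ a, |Real.exp (x a) / (∑ a', Real.exp (x a')) - Real.exp (y a) / (∑ a', Real.exp (y a'))|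
      ≤ 4 * d := by
  have hd : 0 ≤ d := (abs_nonneg _).trans (h (Classical.arbitrary A))
  calc
    _ ≤ ∑ a, 2 * d * (Real.exp (x a) / (∑ a', Real.exp (x a'))
          + Real.exp (y a) / (∑ a', Real.exp (y a'))) := by
      refine Finset.sum_le_sum fun a _ => ?_
      have hxy := softmax_sub_le_two_mul h a
      have hyx := softmax_sub_le_two_mul (fun b => (abs_sub_comm (y b) (x b)).trans_le (h b)) a
      have hp : 0 ≤ 2 * d * (Real.exp (x a) / ∑ a', Real.exp (x a')) := by positivity
      have hq : 0 ≤ 2 * d * (Real.exp (y a) / ∑ a', Real.exp (y a')) := by positivity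
      rw [mul_add]
      exact abs_le.2 ⟨by linarith, by linarith⟩
    _ = 4 * d := by
      rw [← Finset.mul_sum, Finset.sum_add_distrib, sum_softmax_eq_one, sum_softmax_eq_one]
      ring

/-- **L1 Lipschitz property of softmax policies.**
For a finite nonempty set `A`, functions `Q, Q̃ : A → ℝ` and `κ > 0`:
`Σ_a |softmax(Q/κ)(a) − softmax(Q̃/κ)(a)| ≤ (8/κ)·max_a |Q(a) − Q̃(a)|`,
where `softmax(x)(a) = exp(x a) / Σ_{a'} exp(x a')`. -/
theorem softmax_l1_lipschitz
    {A : Type*} [Fintype A] [Nonempty A]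
    (Q Qt : A → ℝ) (κ : ℝ) (hκ : 0 < κ) :
    ∑ a, |Real.exp (Q a / κ) / (∑ a', Real.exp (Q a' / κ))
          - Real.exp (Qt a / κ) / (∑ a', Real.exp (Qt a' / κ))|
      ≤ (8 / κ) * (Finset.univ.sup' Finset.univ_nonempty fun a => |Q a - Qt a|) := by
  set M := Finset.univ.sup' Finset.univ_nonempty fun a => |Q a - Qt a|
  have hM : ∀ a, |Q a - Qt a| ≤ M := fun a =>
    Finset.le_sup' (fun a => |Q a - Qt a|) (Finset.mem_univ a)
  have hd : 0 ≤ M / κ := div_nonneg ((abs_nonneg _).trans (hM (Classical.arbitrary A))) hκ.le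
  have h : ∀ a, |Q a / κ - Qt a / κ| ≤ M / κ := fun a => by
    rw [← sub_div, abs_div, abs_of_pos hκ]
    exact div_le_div_of_nonneg_right (hM a) hκ.le
  calc
    _ ≤ 4 * (M / κ) := sum_abs_softmax_sub_le h
    _ ≤ 8 * (M / κ) := by linarith
    _ = 8 / κ * M := by ring
end

section
/- Softmax value monotonicity. Let f, g: {1,…,H}×S×A → ℝ be reward functions and let κ > 0. For each λ ≥ 0 define the policy π^λ by backward recursion over h = H,…,1: π^λ_h(·|s) = softmax( (Q^{π^λ,f}_{P,h}[κ](s,·) + λ·Q^{π^λ,g}_{P,h}(s,·)) / κ ); this is well defined because these Q-functions at step h depend only on π^λ at steps h+1,…,H. Then the map λ ↦ V^{π^λ,g}_{P,1}(s₁) is monotonically non-decreasing on [0,∞). -/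
/-- Joint backward recursion computing, for the softmax policy
`π^λ_h(·|s) = softmax((Q^{π^λ,f}_{P,h}[κ](s,·) + λ·Q^{π^λ,g}_{P,h}(s,·))/κ)`,
the pair `(V^{π^λ,f}_{P,h}[κ](s), V^{π^λ,g}_{P,h}(s))`; the first argument is the number of
remaining steps, so the value at step `h` of a horizon-`H` MDP is obtained at `(H + 1 - h, h)`. -/
noncomputable def softPairV {S A : Type*} [Fintype S] [Fintype A]
    (P : ℕ → S → A → S → ℝ) (f g : ℕ → S → A → ℝ) (κ lam : ℝ) :
    ℕ → ℕ → S → ℝ × ℝ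
  | 0, _, _ => (0, 0)
  | n + 1, h, s =>
    let Qf : A → ℝ := fun a =>
      f h s a + ∑ s', P h s a s' * (softPairV P f g κ lam n (h + 1) s').1
    let Qg : A → ℝ := fun a =>
      g h s a + ∑ s', P h s a s' * (softPairV P f g κ lam n (h + 1) s').2
    let pol : A → ℝ := fun a =>
      Real.exp ((Qf a + lam * Qg a) / κ) / ∑ a', Real.exp ((Qf a' + lam * Qg a') / κ)
    (∑ a, pol a * (Qf a - κ * Real.log (pol a)), ∑ a, pol a * Qg a)

/-- **Gibbs variational principle.** Among all strictly positive distributions `p`, the softmax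
of `x / κ` maximizes the entropy-regularized expectation `∑ a, p a * (x a - κ * log (p a))`. -/
lemma entropy_regularized_sum_le_softmax {A : Type*} [Fintype A] [Nonempty A]
    {κ : ℝ} (hκ : 0 < κ) (x p : A → ℝ) (hp : ∀ a, 0 < p a) (hp1 : ∑ a, p a = 1) :
    ∑ a, p a * (x a - κ * Real.log (p a)) ≤
      ∑ a, Real.exp (x a / κ) / (∑ a', Real.exp (x a' / κ)) *
        (x a - κ * Real.log (Real.exp (x a / κ) / ∑ a', Real.exp (x a' / κ))) := by
  set Z := ∑ a', Real.exp (x a' / κ) with hZ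
  have hZpos : 0 < Z := Finset.sum_pos (fun _ _ => Real.exp_pos _) Finset.univ_nonempty
  have hlog (a : A) : Real.log (Real.exp (x a / κ) / Z) = x a / κ - Real.log Z := by
    rw [Real.log_div (Real.exp_pos _).ne' hZpos.ne', Real.log_exp]
  have hq1 : ∑ a, Real.exp (x a / κ) / Z = 1 := by
    rw [← Finset.sum_div, ← hZ, div_self hZpos.ne']
  have hconst (a : A) : x a - κ * Real.log (Real.exp (x a / κ) / Z) = κ * Real.log Z := by
    rw [hlog]
    field_simp
    ring
  simp_rw [hconst]
  rw [← Finset.sum_mul, hq1, one_mul]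
  have hterm (a : A) : p a * (x a - κ * Real.log (p a)) ≤
      p a * (κ * Real.log Z) + κ * (Real.exp (x a / κ) / Z - p a) := by
    have hq : 0 < Real.exp (x a / κ) / Z := div_pos (Real.exp_pos _) hZpos
    have h := Real.log_le_sub_one_of_pos (div_pos hq (hp a))
    rw [Real.log_div hq.ne' (hp a).ne'] at h
    have h' := mul_le_mul_of_nonneg_left h (mul_pos hκ (hp a)).le
    have hcancel : κ * p a * (Real.exp (x a / κ) / Z / p a - 1) =
        κ * (Real.exp (x a / κ) / Z - p a) := by
      have := (hp a).ne'
      field_simp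
    rw [hcancel] at h'
    rw [← hconst a]
    linarith
  calc _ ≤ ∑ a, (p a * (κ * Real.log Z) + κ * (Real.exp (x a / κ) / Z - p a)) :=
        Finset.sum_le_sum fun a _ => hterm a
    _ = κ * Real.log Z := by
        rw [Finset.sum_add_distrib, ← Finset.sum_mul, ← Finset.mul_sum,
          Finset.sum_sub_distrib, hq1, hp1]
        ring

/-- The softmax policy with parameter `μ` is optimal for the Lagrangian `f + μ g` among all
softmax policies. -/
lemma softPairV_lagrangian_le {S A : Type*} [Fintype S] [Fintype A] [Nonempty A]
    (P : ℕ → S → A → S → ℝ) (hP : ∀ h s a s', 0 ≤ P h s a s')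
    (f g : ℕ → S → A → ℝ) {κ : ℝ} (hκ : 0 < κ) (lam μ : ℝ) (n h : ℕ) (s : S) :
    (softPairV P f g κ lam n h s).1 + μ * (softPairV P f g κ lam n h s).2 ≤
      (softPairV P f g κ μ n h s).1 + μ * (softPairV P f g κ μ n h s).2 := by
  induction n generalizing h s with
  | zero => simp [softPairV]
  | succ n ih =>
    simp only [softPairV]
    set F : ℝ → A → ℝ := fun l a =>
      f h s a + ∑ s', P h s a s' * (softPairV P f g κ l n (h + 1) s').1 with hF
    set G : ℝ → A → ℝ := fun l a =>
      g h s a + ∑ s', P h s a s' * (softPairV P f g κ l n (h + 1) s').2 with hG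
    set pol : ℝ → A → ℝ := fun l a =>
      Real.exp ((F l a + l * G l a) / κ) / ∑ a', Real.exp ((F l a' + l * G l a') / κ) with hpol
    have hZ (l : ℝ) : 0 < ∑ a', Real.exp ((F l a' + l * G l a') / κ) :=
      Finset.sum_pos (fun _ _ => Real.exp_pos _) Finset.univ_nonempty
    have hpos (l : ℝ) (a : A) : 0 < pol l a := div_pos (Real.exp_pos _) (hZ l)
    have hsum (l : ℝ) : ∑ a, pol l a = 1 := by
      simp only [hpol]
      rw [← Finset.sum_div, div_self (hZ l).ne']
    have hcomb (l : ℝ) : ∑ a, pol l a * (F l a - κ * Real.log (pol l a)) +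
        μ * ∑ a, pol l a * G l a =
        ∑ a, pol l a * (F l a + μ * G l a - κ * Real.log (pol l a)) := by
      rw [Finset.mul_sum, ← Finset.sum_add_distrib]
      exact Finset.sum_congr rfl fun a _ => by ring
    have hQ (a : A) : F lam a + μ * G lam a ≤ F μ a + μ * G μ a := by
      have hsplit (l : ℝ) : F l a + μ * G l a = f h s a + μ * g h s a +
          ∑ s', P h s a s' * ((softPairV P f g κ l n (h + 1) s').1 +
            μ * (softPairV P f g κ l n (h + 1) s').2) := by
        simp only [hF, hG, mul_add, Finset.sum_add_distrib, Finset.mul_sum, mul_left_comm μ]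
        ring
      rw [hsplit, hsplit]
      exact add_le_add_right (Finset.sum_le_sum fun s' _ =>
        mul_le_mul_of_nonneg_left (ih (h + 1) s') (hP h s a s')) _
    change ∑ a, pol lam a * (F lam a - κ * Real.log (pol lam a)) + μ * ∑ a, pol lam a * G lam a ≤
      ∑ a, pol μ a * (F μ a - κ * Real.log (pol μ a)) + μ * ∑ a, pol μ a * G μ a
    rw [hcomb, hcomb]
    calc _ ≤ ∑ a, pol lam a * (F μ a + μ * G μ a - κ * Real.log (pol lam a)) :=
          Finset.sum_le_sum fun a _ =>
            mul_le_mul_of_nonneg_left (sub_le_sub_right (hQ a) _) (hpos lam a).le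
      _ ≤ _ := entropy_regularized_sum_le_softmax hκ (fun a => F μ a + μ * G μ a) (pol lam)
          (hpos lam) (hsum lam)

/-- **Softmax value monotonicity.**
For reward functions `f, g` and `κ > 0`, the utility value `λ ↦ V^{π^λ,g}_{P,1}(s₁)` of the
softmax policy `π^λ_h(·|s) = softmax((Q^{π^λ,f}_{P,h}[κ](s,·) + λ·Q^{π^λ,g}_{P,h}(s,·))/κ)`
is monotonically non-decreasing on `[0,∞)`. -/
theorem softmax_value_monotonicity
    {S A : Type*} [Fintype S] [Fintype A] [Nonempty S] [Nonempty A]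
    (H : ℕ) (hH : 1 ≤ H)
    (P : ℕ → S → A → S → ℝ)
    (hP : ∀ h s a, (∀ s', 0 ≤ P h s a s') ∧ ∑ s', P h s a s' = 1)
    (f g : ℕ → S → A → ℝ) (κ : ℝ) (hκ : 0 < κ) (s₁ : S) :
    MonotoneOn (fun lam => (softPairV P f g κ lam (H + 1 - 1) 1 s₁).2) (Set.Ici 0) := by
  intro l _ m _ hlm
  have hP' := fun h s a => (hP h s a).1
  have hm := softPairV_lagrangian_le P hP' f g hκ l m (H + 1 - 1) 1 s₁
  have hl := softPairV_lagrangian_le P hP' f g hκ m l (H + 1 - 1) 1 s₁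
  rcases hlm.eq_or_lt with rfl | hlt
  · exact le_rfl
  · change (softPairV P f g κ l (H + 1 - 1) 1 s₁).2 ≤ (softPairV P f g κ m (H + 1 - 1) 1 s₁).2
    refine le_of_mul_le_mul_left ?_ (sub_pos.mpr hlt)
    linarith
end

section
/- Existence of a feasible Lagrange multiplier for the perturbed softmax policy. Let ξ > 0, b ∈ ℝ, C_r, C_p, C_† > 0, B_† ≥ 0, let β_h: S×A → [0,1], let r, u: {1,…,H}×S×A → [0,1], write h_κ = h·(1+κ·ln|A|) and H_κ = H·(1+κ·ln|A|), and let κ satisfy 0 < κ ≤ ξ² / (32·H_κ²·(B_†+1)). Let π_sf be a policy with V^{π_sf,u}_{P,1}(s₁) − b ≥ ξ and V^{π_sf,2C_p·β}_{P,1}(s₁) ≤ ξ/2. Let δ^r, δ^u, δ^†: {1,…,H}×S×A → ℝ satisfy, for every h: 0 ≤ δ^r_h ≤ min{2C_r·β_h, H_κ−h_κ}, 0 ≤ δ^u_h ≤ min{2C_p·β_h, H−h}, and 0 ≤ δ^†_h ≤ min{2C_†·β_h, B_†·(H−h)}. For λ ≥ 0 define the policy π^{δ,λ} by backward recursion over h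 = H,…,1: π^{δ,λ}_h(·|s) = softmax( (Q^{π^{δ,λ}, B_†·β+δ^†}_{P,h}(s,·) + Q^{π^{δ,λ}, r+δ^r}_{P,h}[κ](s,·) + λ·Q^{π^{δ,λ}, u−δ^u}_{P,h}(s,·)) / κ ). Then there exists λ^δ ∈ [0, 8·H_κ²·(B_†+1)/ξ] such that for every λ ≥ λ^δ: V^{π^{δ,λ}, u−δ^u}_{P,1}(s₁) ≥ b. -/
/-- Joint backward recursion computing, for the softmax policy
`π^{δ,λ}_h(·|s) = softmax((Q^{π,gd}_{P,h}(s,·) + Q^{π,gr}_{P,h}[κ](s,·) + λ·Q^{π,gu}_{P,h}(s,·))/κ)`,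
the triple `(V^{π,gd}_{P,h}(s), V^{π,gr}_{P,h}[κ](s), V^{π,gu}_{P,h}(s))`; the first `ℕ` argument
is the number of remaining steps (value at step `h` of a horizon-`H` MDP is at `(H + 1 - h, h)`). -/
noncomputable def softTripleV {S A : Type*} [Fintype S] [Fintype A]
    (P : ℕ → S → A → S → ℝ) (gd gr gu : ℕ → S → A → ℝ) (κ lam : ℝ) :
    ℕ → ℕ → S → ℝ × ℝ × ℝ
  | 0, _, _ => (0, 0, 0)
  | n + 1, h, s =>
    let Qd : A → ℝ := fun a =>
      gd h s a + ∑ s', P h s a s' * (softTripleV P gd gr gu κ lam n (h + 1) s').1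
    let Qr : A → ℝ := fun a =>
      gr h s a + ∑ s', P h s a s' * (softTripleV P gd gr gu κ lam n (h + 1) s').2.1
    let Qu : A → ℝ := fun a =>
      gu h s a + ∑ s', P h s a s' * (softTripleV P gd gr gu κ lam n (h + 1) s').2.2
    let pol : A → ℝ := fun a =>
      Real.exp ((Qd a + Qr a + lam * Qu a) / κ)
        / ∑ a', Real.exp ((Qd a' + Qr a' + lam * Qu a') / κ)
    (∑ a, pol a * Qd a,
     ∑ a, pol a * (Qr a - κ * Real.log (pol a)),
     ∑ a, pol a * Qu a)

/-- Softmax weights at temperature `κ`. -/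
noncomputable def softmaxWeight {A : Type*} [Fintype A] (κ : ℝ) (x : A → ℝ) (a : A) : ℝ :=
  Real.exp (x a / κ) / ∑ a', Real.exp (x a' / κ)

section Softmax

variable {A : Type*} [Fintype A]

lemma softmaxWeight_nonneg (κ : ℝ) (x : A → ℝ) (a : A) : 0 ≤ softmaxWeight κ x a := by
  unfold softmaxWeight; positivity

variable [Nonempty A]

lemma sum_exp_div_pos (κ : ℝ) (x : A → ℝ) : 0 < ∑ a, Real.exp (x a / κ) :=
  Finset.sum_pos (fun _ _ => Real.exp_pos _) Finset.univ_nonempty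

lemma sum_softmaxWeight (κ : ℝ) (x : A → ℝ) : ∑ a, softmaxWeight κ x a = 1 := by
  unfold softmaxWeight
  rw [← Finset.sum_div, div_self (sum_exp_div_pos κ x).ne']

lemma log_softmaxWeight (κ : ℝ) (x : A → ℝ) (a : A) :
    Real.log (softmaxWeight κ x a) = x a / κ - Real.log (∑ a', Real.exp (x a' / κ)) := by
  unfold softmaxWeight
  rw [Real.log_div (Real.exp_pos _).ne' (sum_exp_div_pos κ x).ne', Real.log_exp]

/-- The softmax distribution attains the log-partition function. -/
lemma sum_softmaxWeight_mul_sub_log {κ : ℝ} (hκ : 0 < κ) (x : A → ℝ) :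
    ∑ a, softmaxWeight κ x a * (x a - κ * Real.log (softmaxWeight κ x a))
      = κ * Real.log (∑ a, Real.exp (x a / κ)) := by
  calc _ = ∑ a, softmaxWeight κ x a * (κ * Real.log (∑ a, Real.exp (x a / κ))) := by
        refine Finset.sum_congr rfl fun a _ => ?_
        rw [log_softmaxWeight]
        congr 1
        field_simp
        ring
    _ = _ := by rw [← Finset.sum_mul, sum_softmaxWeight, one_mul]

/-- Gibbs variational inequality. -/
lemma sum_mul_sub_log_le {κ : ℝ} (hκ : 0 < κ) (x q : A → ℝ)
    (hq : ∀ a, 0 ≤ q a) (hq1 : ∑ a, q a = 1) :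
    ∑ a, q a * (x a - κ * Real.log (q a)) ≤ κ * Real.log (∑ a, Real.exp (x a / κ)) := by
  have key : ∀ a, q a * (x a - κ * Real.log (q a)) ≤
      κ * (softmaxWeight κ x a - q a) + q a * (κ * Real.log (∑ a, Real.exp (x a / κ))) := by
    intro a
    have hpos : 0 < softmaxWeight κ x a :=
      div_pos (Real.exp_pos _) (sum_exp_div_pos κ x)
    have hx : x a = κ * Real.log (softmaxWeight κ x a)
        + κ * Real.log (∑ a, Real.exp (x a / κ)) := by
      rw [log_softmaxWeight]; field_simp; ring
    have hlog : q a * (Real.log (softmaxWeight κ x a) - Real.log (q a))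
        ≤ softmaxWeight κ x a - q a := by
      rcases (hq a).eq_or_lt with h0 | h0
      · rw [← h0]; simpa using hpos.le
      · rw [← Real.log_div hpos.ne' h0.ne']
        calc _ ≤ q a * (softmaxWeight κ x a / q a - 1) :=
              mul_le_mul_of_nonneg_left (Real.log_le_sub_one_of_pos (div_pos hpos h0)) h0.le
          _ = _ := by field_simp
    have := mul_le_mul_of_nonneg_left hlog hκ.le
    rw [hx]
    linarith
  refine (Finset.sum_le_sum fun a _ => key a).trans_eq ?_
  rw [Finset.sum_add_distrib, ← Finset.mul_sum, ← Finset.sum_mul, Finset.sum_sub_distrib,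
    sum_softmaxWeight, hq1]
  ring

lemma sum_mul_neg_log_le {κ : ℝ} (hκ : 0 < κ) (q : A → ℝ)
    (hq : ∀ a, 0 ≤ q a) (hq1 : ∑ a, q a = 1) :
    ∑ a, q a * (- (κ * Real.log (q a))) ≤ κ * Real.log (Fintype.card A) := by
  simpa using sum_mul_sub_log_le hκ (fun _ => 0) q hq hq1

end Softmax

lemma sum_mul_le_of_forall_le {ι : Type*} [Fintype ι] {p f : ι → ℝ} {c : ℝ}
    (hp : ∀ i, 0 ≤ p i) (hp1 : ∑ i, p i = 1) (hf : ∀ i, f i ≤ c) :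
    ∑ i, p i * f i ≤ c := by
  calc _ ≤ ∑ i, p i * c := Finset.sum_le_sum fun i _ => mul_le_mul_of_nonneg_left (hf i) (hp i)
    _ = c := by rw [← Finset.sum_mul, hp1, one_mul]

section SoftTriple

variable {S A : Type*} [Fintype S] [Fintype A]

/-- The combined action value whose softmax defines the recursion in `softTripleV`. -/
noncomputable def softTripleQ (P : ℕ → S → A → S → ℝ) (gd gr gu : ℕ → S → A → ℝ) (κ lam : ℝ)
    (n h : ℕ) (s : S) (a : A) : ℝ :=
  (gd h s a + ∑ s', P h s a s' * (softTripleV P gd gr gu κ lam n (h + 1) s').1)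
    + (gr h s a + ∑ s', P h s a s' * (softTripleV P gd gr gu κ lam n (h + 1) s').2.1)
    + lam * (gu h s a + ∑ s', P h s a s' * (softTripleV P gd gr gu κ lam n (h + 1) s').2.2)

lemma softTripleV_succ (P : ℕ → S → A → S → ℝ) (gd gr gu : ℕ → S → A → ℝ) (κ lam : ℝ)
    (n h : ℕ) (s : S) :
    softTripleV P gd gr gu κ lam (n + 1) h s =
      (∑ a, softmaxWeight κ (softTripleQ P gd gr gu κ lam n h s) a *
        (gd h s a + ∑ s', P h s a s' * (softTripleV P gd gr gu κ lam n (h + 1) s').1),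
       ∑ a, softmaxWeight κ (softTripleQ P gd gr gu κ lam n h s) a *
        ((gr h s a + ∑ s', P h s a s' * (softTripleV P gd gr gu κ lam n (h + 1) s').2.1)
          - κ * Real.log (softmaxWeight κ (softTripleQ P gd gr gu κ lam n h s) a)),
       ∑ a, softmaxWeight κ (softTripleQ P gd gr gu κ lam n h s) a *
        (gu h s a + ∑ s', P h s a s' * (softTripleV P gd gr gu κ lam n (h + 1) s').2.2)) := by
  rw [softTripleV]
  rfl

variable [Nonempty A] {P : ℕ → S → A → S → ℝ} {gd gr gu : ℕ → S → A → ℝ} {κ : ℝ} {H : ℕ}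

lemma softTripleV_lagrangian_succ (hκ : 0 < κ) (lam : ℝ) (n h : ℕ) (s : S) :
    (softTripleV P gd gr gu κ lam (n + 1) h s).1
      + (softTripleV P gd gr gu κ lam (n + 1) h s).2.1
      + lam * (softTripleV P gd gr gu κ lam (n + 1) h s).2.2
      = κ * Real.log (∑ a, Real.exp (softTripleQ P gd gr gu κ lam n h s a / κ)) := by
  rw [← sum_softmaxWeight_mul_sub_log hκ, softTripleV_succ]
  simp only [Finset.mul_sum, ← Finset.sum_add_distrib]
  refine Finset.sum_congr rfl fun a _ => ?_
  simp only [softTripleQ]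
  ring

lemma softTripleV_fst_le (hP : ∀ h s a, (∀ s', 0 ≤ P h s a s') ∧ ∑ s', P h s a s' = 1)
    {c : ℝ} (hgd : ∀ h ∈ Finset.Icc 1 H, ∀ s a, gd h s a ≤ c) (lam : ℝ) (n h : ℕ)
    (h1 : 1 ≤ h) (hn : h + n = H + 1) (s : S) :
    (softTripleV P gd gr gu κ lam n h s).1 ≤ n * c := by
  induction n generalizing h s with
  | zero => simp [softTripleV]
  | succ n ih =>
    rw [softTripleV_succ]
    refine sum_mul_le_of_forall_le (softmaxWeight_nonneg _ _) (sum_softmaxWeight _ _) fun a => ?_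
    have hg := hgd h (Finset.mem_Icc.2 ⟨h1, by omega⟩) s a
    have hV := sum_mul_le_of_forall_le (hP h s a).1 (hP h s a).2
      (fun s' => ih (h + 1) (by omega) (by omega) s')
    push_cast
    linarith

lemma softTripleV_snd_fst_le (hP : ∀ h s a, (∀ s', 0 ≤ P h s a s') ∧ ∑ s', P h s a s' = 1)
    (hκ : 0 < κ) {c : ℝ} (hgr : ∀ h ∈ Finset.Icc 1 H, ∀ s a, gr h s a ≤ c) (lam : ℝ) (n h : ℕ)
    (h1 : 1 ≤ h) (hn : h + n = H + 1) (s : S) :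
    (softTripleV P gd gr gu κ lam n h s).2.1 ≤ n * (c + κ * Real.log (Fintype.card A)) := by
  induction n generalizing h s with
  | zero => simp [softTripleV]
  | succ n ih =>
    rw [softTripleV_succ]
    simp only [sub_eq_add_neg]
    rw [Finset.sum_congr rfl fun a _ => mul_add _ _ _, Finset.sum_add_distrib]
    have hent := sum_mul_neg_log_le hκ _
      (softmaxWeight_nonneg κ (softTripleQ P gd gr gu κ lam n h s)) (sum_softmaxWeight _ _)
    have hQ : ∑ a, softmaxWeight κ (softTripleQ P gd gr gu κ lam n h s) a *
        (gr h s a + ∑ s', P h s a s' * (softTripleV P gd gr gu κ lam n (h + 1) s').2.1)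
        ≤ c + n * (c + κ * Real.log (Fintype.card A)) := by
      refine sum_mul_le_of_forall_le (softmaxWeight_nonneg _ _) (sum_softmaxWeight _ _)
        fun a => ?_
      have hg := hgr h (Finset.mem_Icc.2 ⟨h1, by omega⟩) s a
      have hV := sum_mul_le_of_forall_le (hP h s a).1 (hP h s a).2
        (fun s' => ih (h + 1) (by omega) (by omega) s')
      linarith
    push_cast
    linarith

/-- The Lagrangian of the softmax policy dominates the constraint value of any comparator. -/
lemma le_softTripleV_lagrangian
    (hP : ∀ h s a, (∀ s', 0 ≤ P h s a s') ∧ ∑ s', P h s a s' = 1) (hκ : 0 < κ)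
    {pol : ℕ → S → A → ℝ} (hpol : ∀ h s, (∀ a, 0 ≤ pol h s a) ∧ ∑ a, pol h s a = 1)
    {lam : ℝ} {u v : ℕ → S → A → ℝ}
    (hg : ∀ h ∈ Finset.Icc 1 H, ∀ s a,
      lam * (u h s a - v h s a) ≤ gd h s a + gr h s a + lam * gu h s a)
    (n h : ℕ) (h1 : 1 ≤ h) (hn : h + n = H + 1) (s : S) :
    lam * (Vaux P pol u 0 n h s - Vaux P pol v 0 n h s) ≤
      (softTripleV P gd gr gu κ lam n h s).1 + (softTripleV P gd gr gu κ lam n h s).2.1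
        + lam * (softTripleV P gd gr gu κ lam n h s).2.2 := by
  induction n generalizing h s with
  | zero => simp [softTripleV, Vaux]
  | succ n ih =>
    rw [softTripleV_lagrangian_succ hκ]
    refine le_trans ?_ (sum_mul_sub_log_le hκ _ (pol h s) (hpol h s).1 (hpol h s).2)
    simp only [Vaux, zero_mul, sub_zero]
    rw [← Finset.sum_sub_distrib, Finset.mul_sum]
    refine Finset.sum_le_sum fun a _ => ?_
    have hlog : Real.log (pol h s a) ≤ 0 := by
      refine Real.log_nonpos ((hpol h s).1 a) ?_
      rw [← (hpol h s).2]
      exact Finset.single_le_sum (fun i _ => (hpol h s).1 i) (Finset.mem_univ a)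
    have hκlog : κ * Real.log (pol h s a) ≤ 0 := mul_nonpos_of_nonneg_of_nonpos hκ.le hlog
    have hr := hg h (Finset.mem_Icc.2 ⟨h1, by omega⟩) s a
    have hV : ∑ s', P h s a s' *
        (lam * (Vaux P pol u 0 n (h + 1) s' - Vaux P pol v 0 n (h + 1) s')) ≤
        ∑ s', P h s a s' * ((softTripleV P gd gr gu κ lam n (h + 1) s').1
          + (softTripleV P gd gr gu κ lam n (h + 1) s').2.1
          + lam * (softTripleV P gd gr gu κ lam n (h + 1) s').2.2) :=
      Finset.sum_le_sum fun s' _ =>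
        mul_le_mul_of_nonneg_left (ih (h + 1) (by omega) (by omega) s') ((hP h s a).1 s')
    simp only [mul_add, mul_sub, Finset.sum_add_distrib, Finset.sum_sub_distrib,
      mul_left_comm _ lam, ← Finset.mul_sum] at hV
    rw [← mul_sub, mul_left_comm]
    refine mul_le_mul_of_nonneg_left ?_ ((hpol h s).1 a)
    unfold softTripleQ
    linarith

end SoftTriple

/-- **Existence of a feasible Lagrange multiplier for the perturbed softmax policy.**
There exists `λ^δ ∈ [0, 8·H_κ²·(B_†+1)/ξ]` such that for every `λ ≥ λ^δ`, the softmax policy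
`π^{δ,λ}` (built from the perturbed rewards `B_†·β+δ^†`, `r+δ^r`, `u−δ^u`) satisfies
`V^{π^{δ,λ},u−δ^u}_{P,1}(s₁) ≥ b`. -/
theorem exists_feasible_lambda
    {S A : Type*} [Fintype S] [Fintype A] [Nonempty S] [Nonempty A]
    (H : ℕ) (hH : 1 ≤ H)
    (P : ℕ → S → A → S → ℝ)
    (hP : ∀ h s a, (∀ s', 0 ≤ P h s a s') ∧ ∑ s', P h s a s' = 1)
    (s₁ : S) (ξ b Cr Cp Cd Bd : ℝ)
    (hξ : 0 < ξ) (hCr : 0 < Cr) (hCp : 0 < Cp) (hCd : 0 < Cd) (hBd : 0 ≤ Bd)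
    (β r u : ℕ → S → A → ℝ)
    (hβ : ∀ h s a, β h s a ∈ Set.Icc (0:ℝ) 1)
    (hr : ∀ h s a, r h s a ∈ Set.Icc (0:ℝ) 1)
    (hu : ∀ h s a, u h s a ∈ Set.Icc (0:ℝ) 1)
    (κ : ℝ) (hκ : 0 < κ)
    (hκle : κ ≤ ξ ^ 2 /
      (32 * (H * (1 + κ * Real.log (Fintype.card A))) ^ 2 * (Bd + 1)))
    (πsf : ℕ → S → A → ℝ)
    (hπsf : ∀ h s, (∀ a, 0 ≤ πsf h s a) ∧ ∑ a, πsf h s a = 1)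
    (hπsf_safe : Vval H P πsf u 0 1 s₁ - b ≥ ξ)
    (hπsf_conf : Vval H P πsf (fun h s a => 2 * Cp * β h s a) 0 1 s₁ ≤ ξ / 2)
    (δr δu δd : ℕ → S → A → ℝ)
    (hδr : ∀ h ∈ Finset.Icc 1 H, ∀ s a, 0 ≤ δr h s a ∧
      δr h s a ≤ min (2 * Cr * β h s a)
        (H * (1 + κ * Real.log (Fintype.card A)) - h * (1 + κ * Real.log (Fintype.card A))))
    (hδu : ∀ h ∈ Finset.Icc 1 H, ∀ s a, 0 ≤ δu h s a ∧
      δu h s a ≤ min (2 * Cp * β h s a) ((H : ℝ) - h))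
    (hδd : ∀ h ∈ Finset.Icc 1 H, ∀ s a, 0 ≤ δd h s a ∧
      δd h s a ≤ min (2 * Cd * β h s a) (Bd * ((H : ℝ) - h))) :
    ∃ lamδ ∈ Set.Icc 0 (8 * (H * (1 + κ * Real.log (Fintype.card A))) ^ 2 * (Bd + 1) / ξ),
      ∀ lam ≥ lamδ,
        (softTripleV P (fun h s a => Bd * β h s a + δd h s a)
            (fun h s a => r h s a + δr h s a)
            (fun h s a => u h s a - δu h s a) κ lam (H + 1 - 1) 1 s₁).2.2 ≥ b := by
  set L : ℝ := 1 + κ * Real.log (Fintype.card A) with hL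
  have hlogA : 0 ≤ κ * Real.log (Fintype.card A) :=
    mul_nonneg hκ.le (Real.log_natCast_nonneg _)
  have hL1 : 1 ≤ L := by linarith
  have hH1 : (1 : ℝ) ≤ H := by exact_mod_cast hH
  have hM : 0 < (H * L) ^ 2 * (Bd + 1) := by positivity
  refine ⟨8 * (H * L) ^ 2 * (Bd + 1) / ξ, ⟨by positivity, le_rfl⟩, fun lam hlam => ?_⟩
  have hlamξ : 8 * ((H * L) ^ 2 * (Bd + 1)) ≤ lam * ξ := by
    have := (div_le_iff₀ hξ).1 hlam
    linarith
  have hlam0 : 0 < lam := pos_of_mul_pos_left (by linarith) hξ.le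
  simp only [Nat.add_sub_cancel]
  have hfst := softTripleV_fst_le (H := H) (P := P) (κ := κ)
    (gd := fun h s a => Bd * β h s a + δd h s a) (gr := fun h s a => r h s a + δr h s a)
    (gu := fun h s a => u h s a - δu h s a) (c := Bd * H) hP
    (by
      intro h hh s a
      have h1 : (1 : ℝ) ≤ h := by exact_mod_cast (Finset.mem_Icc.1 hh).1
      have hd := (hδd h hh s a).2.trans (min_le_right _ _)
      have hb := mul_le_mul_of_nonneg_left (hβ h s a).2 hBd
      have := mul_le_mul_of_nonneg_left h1 hBd
      linarith) lam H 1 le_rfl (by omega) s₁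
  have hsnd := softTripleV_snd_fst_le (H := H) (P := P)
    (gd := fun h s a => Bd * β h s a + δd h s a) (gr := fun h s a => r h s a + δr h s a)
    (gu := fun h s a => u h s a - δu h s a) (c := 1 + (H * L - L)) hP hκ
    (by
      intro h hh s a
      have h1 : (1 : ℝ) ≤ h := by exact_mod_cast (Finset.mem_Icc.1 hh).1
      have hd := (hδr h hh s a).2.trans (min_le_right _ _)
      have hb := (hr h s a).2
      have : 1 * L ≤ h * L := mul_le_mul_of_nonneg_right h1 (by linarith)
      linarith) lam H 1 le_rfl (by omega) s₁
  have hlag := le_softTripleV_lagrangian (H := H)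
    (gd := fun h s a => Bd * β h s a + δd h s a) (gr := fun h s a => r h s a + δr h s a)
    (gu := fun h s a => u h s a - δu h s a) (u := u) (v := fun h s a => 2 * Cp * β h s a)
    (lam := lam) hP hκ hπsf
    (by
      intro h hh s a
      have hd := (hδu h hh s a).2.trans (min_le_left _ _)
      have := mul_le_mul_of_nonneg_left hd hlam0.le
      have hβd := mul_nonneg hBd (hβ h s a).1
      have hd0 := (hδd h hh s a).1
      have hr0 := (hr h s a).1
      have hδr0 := (hδr h hh s a).1
      linarith) H 1 le_rfl (by omega) s₁
  simp only [Vval, Nat.add_sub_cancel] at hπsf_safe hπsf_conf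
  set T := softTripleV P (fun h s a => Bd * β h s a + δd h s a)
    (fun h s a => r h s a + δr h s a) (fun h s a => u h s a - δu h s a) κ lam H 1 s₁
  have hV : lam * (b + ξ / 2) ≤ lam * (Vaux P πsf u 0 H 1 s₁
      - Vaux P πsf (fun h s a => 2 * Cp * β h s a) 0 H 1 s₁) :=
    mul_le_mul_of_nonneg_left (by linarith) hlam0.le
  have hbound1 : (H : ℝ) * (Bd * H) ≤ (H * L) ^ 2 * Bd := by
    have : 1 ≤ L ^ 2 := one_le_pow₀ hL1
    have := mul_le_mul_of_nonneg_left this (show 0 ≤ (H : ℝ) ^ 2 * Bd by positivity)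
    linarith
  have hbound2 : (H : ℝ) * (1 + (H * L - L) + κ * Real.log (Fintype.card A)) ≤ (H * L) ^ 2 := by
    have hE : κ * Real.log (Fintype.card A) = L - 1 := by rw [hL]; ring
    rw [hE]
    have := mul_le_mul_of_nonneg_left hL1 (show 0 ≤ (H : ℝ) ^ 2 * L by positivity)
    linarith
  have : lam * b ≤ lam * T.2.2 := by linarith
  exact le_of_mul_le_mul_left this hlam0
end

section
/- Optimistic-pessimistic sandwich for the clipped value functions. Fix a policy π and κ ≥ 0, and assume that for every h ∈ {1,…,H} and (s,a) ∈ S×A: |(P̂_h V̄^{π,r}_{h+1}[κ])(s,a) − (P_h V̄^{π,r}_{h+1}[κ])(s,a)| ≤ C_r·β_h(s,a), |(P̂_h V̲^{π,u}_{h+1})(s,a) − (P_h V̲^{π,u}_{h+1})(s,a)| ≤ C_p·β_h(s,a), and |(P̂_h V̄^{π,†}_{h+1})(s,a) − (P_h V̄^{π,†}_{h+1})(s,a)| ≤ C_†·β_h(s,a). Then for every h ∈ {1,…,H}, pointwise on S×A and S respectively: Q^{π,r}_{P,h}[κ] ≤ Q̄^{π,r}_h[κ] ≤ Q^{π,r+2C_r·β}_{P,h}[κ]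 and V^{π,r}_{P,h}[κ] ≤ V̄^{π,r}_h[κ] ≤ V^{π,r+2C_r·β}_{P,h}[κ]; Q^{π,B_†·β}_{P,h} ≤ Q̄^{π,†}_h ≤ Q^{π,(B_†+2C_†)·β}_{P,h} and V^{π,B_†·β}_{P,h} ≤ V̄^{π,†}_h ≤ V^{π,(B_†+2C_†)·β}_{P,h}; Q^{π,u−2C_p·β}_{P,h} ≤ Q̲^{π,u}_h ≤ Q^{π,u}_{P,h} and V^{π,u−2C_p·β}_{P,h} ≤ V̲^{π,u}_h ≤ V^{π,u}_{P,h}. -/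
/-- `Qval H P pol g κ h s a = Q^{pol,g}_{P,h}[κ](s,a)` for a horizon-`H` MDP. -/
noncomputable def Qval {S A : Type*} [Fintype S] [Fintype A] (H : ℕ)
    (P : ℕ → S → A → S → ℝ) (pol : ℕ → S → A → ℝ) (g : ℕ → S → A → ℝ) (κ : ℝ)
    (h : ℕ) (s : S) (a : A) : ℝ :=
  g h s a + ∑ s', P h s a s' * Vval H P pol g κ (h + 1) s'

/-- Generic clipped value recursion (on the number of remaining steps):
`Q_h = base_h + clip{bonus_h + P̂_h V_{h+1}, 0, hi h}` and
`V_h(s) = Σ_a pol_h(a|s)·(Q_h(s,a) − κ·ln pol_h(a|s))`. -/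
noncomputable def ClipVAux {S A : Type*} [Fintype S] [Fintype A]
    (Phat : ℕ → (S → ℝ) → S → A → ℝ) (pol : ℕ → S → A → ℝ)
    (base bonus : ℕ → S → A → ℝ) (hi : ℕ → ℝ) (κ : ℝ) :
    ℕ → ℕ → S → ℝ
  | 0, _, _ => 0
  | n + 1, h, s => ∑ a, pol h s a *
      ((base h s a +
          min (max (bonus h s a +
            Phat h (fun s' => ClipVAux Phat pol base bonus hi κ n (h + 1) s') s a) 0) (hi h))
        - κ * Real.log (pol h s a))

/-- Clipped value function at step `h` of a horizon-`H` MDP. -/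
noncomputable def ClipV {S A : Type*} [Fintype S] [Fintype A] (H : ℕ)
    (Phat : ℕ → (S → ℝ) → S → A → ℝ) (pol : ℕ → S → A → ℝ)
    (base bonus : ℕ → S → A → ℝ) (hi : ℕ → ℝ) (κ : ℝ) (h : ℕ) (s : S) : ℝ :=
  ClipVAux Phat pol base bonus hi κ (H + 1 - h) h s

/-- Clipped action-value function at step `h` of a horizon-`H` MDP. -/
noncomputable def ClipQ {S A : Type*} [Fintype S] [Fintype A] (H : ℕ)
    (Phat : ℕ → (S → ℝ) → S → A → ℝ) (pol : ℕ → S → A → ℝ)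
    (base bonus : ℕ → S → A → ℝ) (hi : ℕ → ℝ) (κ : ℝ) (h : ℕ) (s : S) (a : A) : ℝ :=
  base h s a +
    min (max (bonus h s a +
      Phat h (fun s' => ClipV H Phat pol base bonus hi κ (h + 1) s') s a) 0) (hi h)

section Clipped

variable {S A : Type*} [Fintype S] [Fintype A]

/-- `V̄^{π,r}_h[κ]`: optimistic clipped reward value function. -/
noncomputable def VbarR (H : ℕ) (Phat : ℕ → (S → ℝ) → S → A → ℝ) (pol : ℕ → S → A → ℝ)
    (r β : ℕ → S → A → ℝ) (Cr κ : ℝ) : ℕ → S → ℝ :=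
  ClipV H Phat pol r (fun h s a => Cr * β h s a)
    (fun h => ((H : ℝ) - h) * (1 + κ * Real.log (Fintype.card A))) κ

/-- `Q̄^{π,r}_h[κ]`: optimistic clipped reward action-value function. -/
noncomputable def QbarR (H : ℕ) (Phat : ℕ → (S → ℝ) → S → A → ℝ) (pol : ℕ → S → A → ℝ)
    (r β : ℕ → S → A → ℝ) (Cr κ : ℝ) : ℕ → S → A → ℝ :=
  ClipQ H Phat pol r (fun h s a => Cr * β h s a)
    (fun h => ((H : ℝ) - h) * (1 + κ * Real.log (Fintype.card A))) κ

/-- `V̄^{π,†}_h`: clipped pessimism-compensation value function. -/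
noncomputable def VbarD (H : ℕ) (Phat : ℕ → (S → ℝ) → S → A → ℝ) (pol : ℕ → S → A → ℝ)
    (β : ℕ → S → A → ℝ) (Cd Bd : ℝ) : ℕ → S → ℝ :=
  ClipV H Phat pol (fun h s a => Bd * β h s a) (fun h s a => Cd * β h s a)
    (fun h => Bd * ((H : ℝ) - h)) 0

/-- `Q̄^{π,†}_h`: clipped pessimism-compensation action-value function. -/
noncomputable def QbarD (H : ℕ) (Phat : ℕ → (S → ℝ) → S → A → ℝ) (pol : ℕ → S → A → ℝ)
    (β : ℕ → S → A → ℝ) (Cd Bd : ℝ) : ℕ → S → A → ℝ :=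
  ClipQ H Phat pol (fun h s a => Bd * β h s a) (fun h s a => Cd * β h s a)
    (fun h => Bd * ((H : ℝ) - h)) 0

/-- `V̲^{π,u}_h`: pessimistic clipped utility value function. -/
noncomputable def VunderU (H : ℕ) (Phat : ℕ → (S → ℝ) → S → A → ℝ) (pol : ℕ → S → A → ℝ)
    (u β : ℕ → S → A → ℝ) (Cp : ℝ) : ℕ → S → ℝ :=
  ClipV H Phat pol u (fun h s a => -(Cp * β h s a)) (fun h => (H : ℝ) - h) 0

/-- `Q̲^{π,u}_h`: pessimistic clipped utility action-value function. -/
noncomputable def QunderU (H : ℕ) (Phat : ℕ → (S → ℝ) → S → A → ℝ) (pol : ℕ → S → A → ℝ)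
    (u β : ℕ → S → A → ℝ) (Cp : ℝ) : ℕ → S → A → ℝ :=
  ClipQ H Phat pol u (fun h s a => -(Cp * β h s a)) (fun h => (H : ℝ) - h) 0

end Clipped

theorem sum_mul_neg_log_le_log_card {A : Type*} [Fintype A] [Nonempty A] (p : A → ℝ)
    (hp : ∀ a, 0 ≤ p a) (hsum : ∑ a, p a = 1) :
    ∑ a, p a * -Real.log (p a) ≤ Real.log (Fintype.card A) := by
  have hn : (0 : ℝ) < Fintype.card A := by exact_mod_cast Fintype.card_pos
  have key : ∀ a, p a * -Real.log (p a) ≤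
      p a * Real.log (Fintype.card A) + ((Fintype.card A : ℝ)⁻¹ - p a) := by
    intro a
    rcases (hp a).eq_or_lt with h0 | h0
    · rw [← h0]
      simp
    · have h1 := Real.log_le_sub_one_of_pos (inv_pos.mpr (mul_pos hn h0))
      rw [Real.log_inv, Real.log_mul hn.ne' h0.ne'] at h1
      have h2 := mul_le_mul_of_nonneg_left h1 h0.le
      have h3 : p a * ((Fintype.card A * p a)⁻¹ - 1) = (Fintype.card A : ℝ)⁻¹ - p a := by
        field_simp
      linarith
  calc ∑ a, p a * -Real.log (p a)
      ≤ ∑ a, (p a * Real.log (Fintype.card A) + ((Fintype.card A : ℝ)⁻¹ - p a)) :=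
        Finset.sum_le_sum fun a _ => key a
    _ = Real.log (Fintype.card A) := by
        rw [Finset.sum_add_distrib, ← Finset.sum_mul, Finset.sum_sub_distrib, hsum]
        simp

theorem sum_mul_mem_Icc {ι : Type*} [Fintype ι] {p f : ι → ℝ} {b : ℝ}
    (hp : ∀ i, 0 ≤ p i) (hsum : ∑ i, p i = 1) (hf : ∀ i, f i ∈ Set.Icc 0 b) :
    ∑ i, p i * f i ∈ Set.Icc 0 b := by
  refine ⟨Finset.sum_nonneg fun i _ => mul_nonneg (hp i) (hf i).1, ?_⟩
  calc ∑ i, p i * f i ≤ ∑ i, p i * b :=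
        Finset.sum_le_sum fun i _ => mul_le_mul_of_nonneg_left (hf i).2 (hp i)
    _ = b := by rw [← Finset.sum_mul, hsum, one_mul]

section Recursion

variable {S A : Type*} [Fintype S] [Fintype A]

theorem Vval_of_le {H h : ℕ} (hh : h ≤ H) (P : ℕ → S → A → S → ℝ) (pol g : ℕ → S → A → ℝ)
    (κ : ℝ) (s : S) :
    Vval H P pol g κ h s =
      ∑ a, pol h s a * (Qval H P pol g κ h s a - κ * Real.log (pol h s a)) := by
  have e : H + 1 - h = (H + 1 - (h + 1)) + 1 := by omega
  unfold Vval
  rw [e]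
  rfl

theorem ClipV_of_le {H h : ℕ} (hh : h ≤ H) (Phat : ℕ → (S → ℝ) → S → A → ℝ)
    (pol base bonus : ℕ → S → A → ℝ) (hi : ℕ → ℝ) (κ : ℝ) (s : S) :
    ClipV H Phat pol base bonus hi κ h s =
      ∑ a, pol h s a *
        (ClipQ H Phat pol base bonus hi κ h s a - κ * Real.log (pol h s a)) := by
  have e : H + 1 - h = (H + 1 - (h + 1)) + 1 := by omega
  unfold ClipV
  rw [e]
  rfl

theorem Vval_succ_horizon (H : ℕ) (P : ℕ → S → A → S → ℝ) (pol g : ℕ → S → A → ℝ) (κ : ℝ)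
    (s : S) : Vval H P pol g κ (H + 1) s = 0 := by
  simp [Vval, Vaux]

theorem ClipV_succ_horizon (H : ℕ) (Phat : ℕ → (S → ℝ) → S → A → ℝ)
    (pol base bonus : ℕ → S → A → ℝ) (hi : ℕ → ℝ) (κ : ℝ) (s : S) :
    ClipV H Phat pol base bonus hi κ (H + 1) s = 0 := by
  simp [ClipV, ClipVAux]

theorem ClipV_mem_Icc [Nonempty A] {H h : ℕ} (hh : h ≤ H + 1)
    (Phat : ℕ → (S → ℝ) → S → A → ℝ) {pol base : ℕ → S → A → ℝ} (bonus : ℕ → S → A → ℝ)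
    {hi : ℕ → ℝ} {κ M : ℝ} (hκ : 0 ≤ κ) (hM : 0 ≤ M)
    (hpol : ∀ h s, (∀ a, 0 ≤ pol h s a) ∧ ∑ a, pol h s a = 1)
    (hbase : ∀ h s a, base h s a ∈ Set.Icc 0 M)
    (hhi : ∀ h, hi h = ((H : ℝ) - h) * (M + κ * Real.log (Fintype.card A))) (s : S) :
    ClipV H Phat pol base bonus hi κ h s ∈
      Set.Icc 0 (((H : ℝ) + 1 - h) * (M + κ * Real.log (Fintype.card A))) := by
  rcases hh.eq_or_lt with rfl | hlt
  · rw [ClipV_succ_horizon]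
    simp
  have hle : h ≤ H := by omega
  have hL : 0 ≤ M + κ * Real.log (Fintype.card A) :=
    add_nonneg hM (mul_nonneg hκ (Real.log_natCast_nonneg _))
  have hhi0 : 0 ≤ hi h := by
    rw [hhi]
    exact mul_nonneg (sub_nonneg.mpr (by exact_mod_cast hle)) hL
  have hQ : ∀ a, ClipQ H Phat pol base bonus hi κ h s a ∈ Set.Icc 0 (M + hi h) := fun a =>
    ⟨add_nonneg (hbase h s a).1 (le_min (le_max_right _ _) hhi0),
      add_le_add (hbase h s a).2 (min_le_right _ _)⟩
  obtain ⟨hp, hsum⟩ := hpol h s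
  have hQsum := sum_mul_mem_Icc hp hsum hQ
  have hent0 : 0 ≤ ∑ a, pol h s a * -Real.log (pol h s a) :=
    Finset.sum_nonneg fun a _ => mul_nonneg (hp a) <| neg_nonneg.mpr <|
      Real.log_nonpos (hp a) <|
        hsum ▸ Finset.single_le_sum (fun b _ => hp b) (Finset.mem_univ a)
  have hent := sum_mul_neg_log_le_log_card (pol h s) hp hsum
  have hsplit : ClipV H Phat pol base bonus hi κ h s =
      ∑ a, pol h s a * ClipQ H Phat pol base bonus hi κ h s a +
        κ * ∑ a, pol h s a * -Real.log (pol h s a) := by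
    rw [ClipV_of_le hle, Finset.mul_sum, ← Finset.sum_add_distrib]
    exact Finset.sum_congr rfl fun a _ => by ring
  rw [hsplit]
  refine ⟨add_nonneg hQsum.1 (mul_nonneg hκ hent0), ?_⟩
  have h1 := mul_le_mul_of_nonneg_left hent hκ
  have h2 := hQsum.2
  rw [hhi] at h2
  linarith

/-- If `P̂` has error at most `err` on the clipped value function, then the clipped value
functions lie between the values for rewards `glo` and `ghi`, provided these absorb the bonus
and the error. -/
theorem ClipQ_ClipV_sandwich [Nonempty A] {H : ℕ} {P : ℕ → S → A → S → ℝ}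
    (hP : ∀ h s a, (∀ s', 0 ≤ P h s a s') ∧ ∑ s', P h s a s' = 1)
    {Phat : ℕ → (S → ℝ) → S → A → ℝ} {pol base bonus err glo ghi : ℕ → S → A → ℝ}
    {hi : ℕ → ℝ} {κ M : ℝ} (hκ : 0 ≤ κ) (hM : 0 ≤ M)
    (hpol : ∀ h s, (∀ a, 0 ≤ pol h s a) ∧ ∑ a, pol h s a = 1)
    (hbase : ∀ h s a, base h s a ∈ Set.Icc 0 M)
    (hhi : ∀ h, hi h = ((H : ℝ) - h) * (M + κ * Real.log (Fintype.card A)))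
    (hacc : ∀ h ∈ Finset.Icc 1 H, ∀ s a,
      |Phat h (ClipV H Phat pol base bonus hi κ (h + 1)) s a
        - ∑ s', P h s a s' * ClipV H Phat pol base bonus hi κ (h + 1) s'| ≤ err h s a)
    (hlo : ∀ h s a, glo h s a ≤ base h s a)
    (hlo' : ∀ h s a, glo h s a ≤ base h s a + bonus h s a - err h s a)
    (hup : ∀ h s a, base h s a ≤ ghi h s a)
    (hup' : ∀ h s a, base h s a + bonus h s a + err h s a ≤ ghi h s a)
    {h : ℕ} (hh : h ∈ Finset.Icc 1 H) (s : S) :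
    (∀ a, Qval H P pol glo κ h s a ≤ ClipQ H Phat pol base bonus hi κ h s a ∧
      ClipQ H Phat pol base bonus hi κ h s a ≤ Qval H P pol ghi κ h s a) ∧
    Vval H P pol glo κ h s ≤ ClipV H Phat pol base bonus hi κ h s ∧
      ClipV H Phat pol base bonus hi κ h s ≤ Vval H P pol ghi κ h s := by
  have hQ : ∀ h ∈ Finset.Icc 1 H,
      (∀ s, Vval H P pol glo κ (h + 1) s ≤ ClipV H Phat pol base bonus hi κ (h + 1) s ∧
        ClipV H Phat pol base bonus hi κ (h + 1) s ≤ Vval H P pol ghi κ (h + 1) s) →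
      ∀ s a, Qval H P pol glo κ h s a ≤ ClipQ H Phat pol base bonus hi κ h s a ∧
        ClipQ H Phat pol base bonus hi κ h s a ≤ Qval H P pol ghi κ h s a := by
    intro h hh hV s a
    obtain ⟨hp, hsum⟩ := hP h s a
    have hmem := sum_mul_mem_Icc hp hsum fun s' =>
      ClipV_mem_Icc (h := h + 1) (by have := (Finset.mem_Icc.mp hh).2; omega)
        Phat bonus hκ hM hpol hbase hhi s'
    have hPlo := Finset.sum_le_sum fun s' (_ : s' ∈ Finset.univ) =>
      mul_le_mul_of_nonneg_left (hV s').1 (hp s')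
    have hPhi := Finset.sum_le_sum fun s' (_ : s' ∈ Finset.univ) =>
      mul_le_mul_of_nonneg_left (hV s').2 (hp s')
    have hcap : ((H : ℝ) + 1 - (h + 1 : ℕ)) * (M + κ * Real.log (Fintype.card A)) = hi h := by
      rw [hhi]
      push_cast
      ring
    rw [hcap] at hmem
    obtain ⟨hacc₁, hacc₂⟩ := abs_le.mp (hacc h hh s a)
    have h1 := hlo h s a
    have h2 := hlo' h s a
    have h3 := hup h s a
    have h4 := hup' h s a
    unfold Qval ClipQ
    constructor
    · rw [← sub_le_iff_le_add']
      refine le_min (le_max_of_le_left ?_) ?_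
      · linarith
      · linarith [hmem.2]
    · rw [← le_sub_iff_add_le']
      refine (min_le_left _ _).trans (max_le ?_ ?_)
      · linarith
      · linarith [hmem.1]
  have hVQ : ∀ h ∈ Finset.Icc 1 H, ∀ s,
      (∀ a, Qval H P pol glo κ h s a ≤ ClipQ H Phat pol base bonus hi κ h s a ∧
        ClipQ H Phat pol base bonus hi κ h s a ≤ Qval H P pol ghi κ h s a) →
      Vval H P pol glo κ h s ≤ ClipV H Phat pol base bonus hi κ h s ∧
        ClipV H Phat pol base bonus hi κ h s ≤ Vval H P pol ghi κ h s := by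
    intro h hh s hq
    have hle := (Finset.mem_Icc.mp hh).2
    rw [Vval_of_le hle, ClipV_of_le hle, Vval_of_le hle]
    exact ⟨Finset.sum_le_sum fun a _ =>
        mul_le_mul_of_nonneg_left (sub_le_sub_right (hq a).1 _) ((hpol h s).1 a),
      Finset.sum_le_sum fun a _ =>
        mul_le_mul_of_nonneg_left (sub_le_sub_right (hq a).2 _) ((hpol h s).1 a)⟩
  have hV : ∀ n h, 1 ≤ h → h + n = H + 1 → ∀ s,
      Vval H P pol glo κ h s ≤ ClipV H Phat pol base bonus hi κ h s ∧
        ClipV H Phat pol base bonus hi κ h s ≤ Vval H P pol ghi κ h s := by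
    intro n
    induction n with
    | zero =>
      intro h _ hn s
      obtain rfl : h = H + 1 := hn
      rw [Vval_succ_horizon, ClipV_succ_horizon, Vval_succ_horizon]
      exact ⟨le_rfl, le_rfl⟩
    | succ n ih =>
      intro h h1 hn s
      have hh : h ∈ Finset.Icc 1 H := Finset.mem_Icc.mpr ⟨h1, by omega⟩
      exact hVQ h hh s (hQ h hh (ih (h + 1) (by omega) (by omega)) s)
  have hq := hQ h hh
    (hV (H - h) (h + 1) (by omega) (by have := (Finset.mem_Icc.mp hh).2; omega)) s
  exact ⟨hq, hVQ h hh s hq⟩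

end Recursion

/-- **Optimistic-pessimistic sandwich for the clipped value functions.**
If the estimated transition operator `P̂` is accurate on the clipped value functions of `π`
(up to `C_r·β`, `C_p·β`, `C_†·β` respectively), then pointwise for every `h ∈ {1,…,H}`:
`Q^{π,r}[κ] ≤ Q̄^{π,r}[κ] ≤ Q^{π,r+2C_rβ}[κ]`, `V^{π,r}[κ] ≤ V̄^{π,r}[κ] ≤ V^{π,r+2C_rβ}[κ]`;
`Q^{π,B_†β} ≤ Q̄^{π,†} ≤ Q^{π,(B_†+2C_†)β}`, `V^{π,B_†β} ≤ V̄^{π,†} ≤ V^{π,(B_†+2C_†)β}`;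
`Q^{π,u−2C_pβ} ≤ Q̲^{π,u} ≤ Q^{π,u}`, `V^{π,u−2C_pβ} ≤ V̲^{π,u} ≤ V^{π,u}`. -/
theorem clipped_value_sandwich
    {S A : Type*} [Fintype S] [Fintype A] [Nonempty S] [Nonempty A]
    (H : ℕ) (hH : 1 ≤ H)
    (P : ℕ → S → A → S → ℝ)
    (hP : ∀ h s a, (∀ s', 0 ≤ P h s a s') ∧ ∑ s', P h s a s' = 1)
    (Phat : ℕ → (S → ℝ) → S → A → ℝ)
    (pol : ℕ → S → A → ℝ)
    (hpol : ∀ h s, (∀ a, 0 ≤ pol h s a) ∧ ∑ a, pol h s a = 1)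
    (r u β : ℕ → S → A → ℝ)
    (hr : ∀ h s a, r h s a ∈ Set.Icc (0:ℝ) 1)
    (hu : ∀ h s a, u h s a ∈ Set.Icc (0:ℝ) 1)
    (hβ : ∀ h s a, β h s a ∈ Set.Icc (0:ℝ) 1)
    (Cr Cp Cd Bd κ : ℝ)
    (hCr : 0 < Cr) (hCp : 0 < Cp) (hCd : 0 < Cd) (hBd : 0 ≤ Bd) (hκ : 0 ≤ κ)
    (haccR : ∀ h ∈ Finset.Icc 1 H, ∀ s a,
      |Phat h (VbarR H Phat pol r β Cr κ (h + 1)) s a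
        - ∑ s', P h s a s' * VbarR H Phat pol r β Cr κ (h + 1) s'| ≤ Cr * β h s a)
    (haccU : ∀ h ∈ Finset.Icc 1 H, ∀ s a,
      |Phat h (VunderU H Phat pol u β Cp (h + 1)) s a
        - ∑ s', P h s a s' * VunderU H Phat pol u β Cp (h + 1) s'| ≤ Cp * β h s a)
    (haccD : ∀ h ∈ Finset.Icc 1 H, ∀ s a,
      |Phat h (VbarD H Phat pol β Cd Bd (h + 1)) s a
        - ∑ s', P h s a s' * VbarD H Phat pol β Cd Bd (h + 1) s'| ≤ Cd * β h s a) :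
    ∀ h ∈ Finset.Icc 1 H, ∀ s,
      (∀ a,
        (Qval H P pol r κ h s a ≤ QbarR H Phat pol r β Cr κ h s a ∧
          QbarR H Phat pol r β Cr κ h s a
            ≤ Qval H P pol (fun h' s' a' => r h' s' a' + 2 * Cr * β h' s' a') κ h s a) ∧
        (Qval H P pol (fun h' s' a' => Bd * β h' s' a') 0 h s a
            ≤ QbarD H Phat pol β Cd Bd h s a ∧
          QbarD H Phat pol β Cd Bd h s a
            ≤ Qval H P pol (fun h' s' a' => (Bd + 2 * Cd) * β h' s' a') 0 h s a) ∧
        (Qval H P pol (fun h' s' a' => u h' s' a' - 2 * Cp * β h' s' a') 0 h s a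
            ≤ QunderU H Phat pol u β Cp h s a ∧
          QunderU H Phat pol u β Cp h s a ≤ Qval H P pol u 0 h s a)) ∧
      (Vval H P pol r κ h s ≤ VbarR H Phat pol r β Cr κ h s ∧
        VbarR H Phat pol r β Cr κ h s
          ≤ Vval H P pol (fun h' s' a' => r h' s' a' + 2 * Cr * β h' s' a') κ h s) ∧
      (Vval H P pol (fun h' s' a' => Bd * β h' s' a') 0 h s
          ≤ VbarD H Phat pol β Cd Bd h s ∧
        VbarD H Phat pol β Cd Bd h s
          ≤ Vval H P pol (fun h' s' a' => (Bd + 2 * Cd) * β h' s' a') 0 h s) ∧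
      (Vval H P pol (fun h' s' a' => u h' s' a' - 2 * Cp * β h' s' a') 0 h s
          ≤ VunderU H Phat pol u β Cp h s ∧
        VunderU H Phat pol u β Cp h s ≤ Vval H P pol u 0 h s) := by
  intro h hh s
  have hR := ClipQ_ClipV_sandwich (glo := r)
    (ghi := fun h' s' a' => r h' s' a' + 2 * Cr * β h' s' a')
    hP hκ zero_le_one hpol hr (fun _ => rfl) haccR
    (fun _ _ _ => le_rfl) (fun _ _ _ => by linarith)
    (fun h s a => by nlinarith [(hβ h s a).1]) (fun _ _ _ => by linarith) hh s
  have hD := ClipQ_ClipV_sandwich (glo := fun h' s' a' => Bd * β h' s' a')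
    (ghi := fun h' s' a' => (Bd + 2 * Cd) * β h' s' a')
    hP le_rfl hBd hpol
    (fun h s a => ⟨mul_nonneg hBd (hβ h s a).1, mul_le_of_le_one_right hBd (hβ h s a).2⟩)
    (fun _ => by ring) haccD
    (fun _ _ _ => le_rfl) (fun _ _ _ => by linarith)
    (fun h s a => by nlinarith [(hβ h s a).1]) (fun _ _ _ => by linarith) hh s
  have hU := ClipQ_ClipV_sandwich (ghi := u)
    (glo := fun h' s' a' => u h' s' a' - 2 * Cp * β h' s' a')
    hP le_rfl zero_le_one hpol hu (fun _ => by ring) haccU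
    (fun h s a => by nlinarith [(hβ h s a).1]) (fun _ _ _ => by linarith)
    (fun _ _ _ => le_rfl) (fun _ _ _ => by linarith) hh s
  exact ⟨fun a => ⟨hR.1 a, hD.1 a, hU.1 a⟩, hR.2, hD.2, hU.2⟩
end

section
/- Implicit safe-policy deployment trigger. Let ξ > 0, b ∈ ℝ, κ > 0, and assume C_λ ≥ 8·H_κ²·(B_†+1)/ξ and κ ≤ ξ² / (32·H_κ²·(B_†+1)). Let π^{C_λ} denote the composite softmax policy with parameter λ = C_λ, and assume that for every h ∈ {1,…,H} and (s,a) ∈ S×A: |(P̂_h V̄^{π^{C_λ},r}_{h+1}[κ])(s,a) − (P_h V̄^{π^{C_λ},r}_{h+1}[κ])(s,a)| ≤ C_r·β_h(s,a), |(P̂_h V̲^{π^{C_λ},u}_{h+1})(s,a) − (P_h V̲^{π^{C_λ},u}_{h+1})(s,a)| ≤ C_p·β_h(s,a), and |(P̂_h V̄^{π^{C_λ},†}_{h+1})(s,a) − (P_h V̄^{π^{C_λ},†}_{h+1})(s,a)| ≤ C_†·β_h(s,a). Suppose there is a policy π_sf with V^{π_sf,u}_{P,1}(s₁) − b ≥ ξ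 and V^{π_sf,2C_p·β}_{P,1}(s₁) ≤ ξ/2. Then V̲^{π^{C_λ},u}_1(s₁) ≥ b. -/
/-- Joint backward recursion (on the number of remaining steps) computing, for the composite
softmax policy `π^λ_h(·|s) = softmax((Q̄^{π^λ,†}_h(s,·) + Q̄^{π^λ,r}_h[κ](s,·) + λ·Q̲^{π^λ,u}_h(s,·))/κ)`
built from the clipped value functions, the triple `(V̄^{π^λ,†}_h(s), V̄^{π^λ,r}_h[κ](s), V̲^{π^λ,u}_h(s))`. -/
noncomputable def ClipTripleAux {S A : Type*} [Fintype S] [Fintype A]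
    (Phat : ℕ → (S → ℝ) → S → A → ℝ) (r u β : ℕ → S → A → ℝ)
    (Cr Cp Cd Bd κ lam : ℝ) (H : ℕ) :
    ℕ → ℕ → S → ℝ × ℝ × ℝ
  | 0, _, _ => (0, 0, 0)
  | n + 1, h, s =>
    let Qd : A → ℝ := fun a => Bd * β h s a +
      min (max (Cd * β h s a +
        Phat h (fun s' => (ClipTripleAux Phat r u β Cr Cp Cd Bd κ lam H n (h + 1) s').1) s a) 0)
        (Bd * ((H : ℝ) - h))
    let Qr : A → ℝ := fun a => r h s a +
      min (max (Cr * β h s a +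
        Phat h (fun s' => (ClipTripleAux Phat r u β Cr Cp Cd Bd κ lam H n (h + 1) s').2.1) s a) 0)
        (((H : ℝ) - h) * (1 + κ * Real.log (Fintype.card A)))
    let Qu : A → ℝ := fun a => u h s a +
      min (max (-(Cp * β h s a) +
        Phat h (fun s' => (ClipTripleAux Phat r u β Cr Cp Cd Bd κ lam H n (h + 1) s').2.2) s a) 0)
        ((H : ℝ) - h)
    let pol : A → ℝ := fun a =>
      Real.exp ((Qd a + Qr a + lam * Qu a) / κ)
        / ∑ a', Real.exp ((Qd a' + Qr a' + lam * Qu a') / κ)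
    (∑ a, pol a * Qd a,
     ∑ a, pol a * (Qr a - κ * Real.log (pol a)),
     ∑ a, pol a * Qu a)

/-- Clipped value-function triple `(V̄^{π^λ,†}_h, V̄^{π^λ,r}_h[κ], V̲^{π^λ,u}_h)` of the composite
softmax policy with parameter `λ`, at step `h` of a horizon-`H` MDP. -/
noncomputable def ClipTripleV {S A : Type*} [Fintype S] [Fintype A]
    (Phat : ℕ → (S → ℝ) → S → A → ℝ) (r u β : ℕ → S → A → ℝ)
    (Cr Cp Cd Bd κ lam : ℝ) (H : ℕ) (h : ℕ) (s : S) : ℝ × ℝ × ℝ :=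
  ClipTripleAux Phat r u β Cr Cp Cd Bd κ lam H (H + 1 - h) h s

/-- **Gibbs' inequality** for finitely supported distributions. -/
lemma sum_mul_log_le_sum_mul_log {A : Type*} [Fintype A] {p q : A → ℝ}
    (hp : ∀ a, 0 < p a) (hp1 : ∑ a, p a = 1) (hq : ∀ a, 0 ≤ q a) (hq1 : ∑ a, q a = 1) :
    ∑ a, q a * Real.log (p a) ≤ ∑ a, q a * Real.log (q a) := by
  have key : ∀ a, q a * Real.log (p a) - q a * Real.log (q a) ≤ p a - q a := by
    intro a
    rcases (hq a).eq_or_lt with h0 | h0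
    · simp [← h0, (hp a).le]
    · have h1 := Real.log_le_sub_one_of_pos (div_pos (hp a) h0)
      rw [Real.log_div (hp a).ne' h0.ne'] at h1
      have h2 := mul_le_mul_of_nonneg_left h1 h0.le
      have h3 : q a * (p a / q a - 1) = p a - q a := by field_simp
      linarith [mul_sub (q a) (Real.log (p a)) (Real.log (q a))]
  have h := Finset.sum_le_sum fun a (_ : a ∈ Finset.univ) => key a
  rw [Finset.sum_sub_distrib, Finset.sum_sub_distrib, hp1, hq1] at h
  linarith

lemma sum_mul_log_nonpos {A : Type*} [Fintype A] {q : A → ℝ}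
    (hq : ∀ a, 0 ≤ q a) (hq1 : ∑ a, q a = 1) : ∑ a, q a * Real.log (q a) ≤ 0 :=
  Finset.sum_nonpos fun a _ => mul_nonpos_of_nonneg_of_nonpos (hq a) <|
    Real.log_nonpos (hq a) <|
      hq1 ▸ Finset.single_le_sum (fun b _ => hq b) (Finset.mem_univ a)

lemma neg_log_card_le_sum_mul_log {A : Type*} [Fintype A] [Nonempty A] {q : A → ℝ}
    (hq : ∀ a, 0 ≤ q a) (hq1 : ∑ a, q a = 1) :
    -Real.log (Fintype.card A) ≤ ∑ a, q a * Real.log (q a) := by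
  have hc : (0 : ℝ) < Fintype.card A := by exact_mod_cast Fintype.card_pos
  have h := sum_mul_log_le_sum_mul_log (p := fun _ : A => (Fintype.card A : ℝ)⁻¹)
    (fun _ => inv_pos.2 hc) (by simp [hc.ne']) hq hq1
  rwa [← Finset.sum_mul, hq1, one_mul, Real.log_inv] at h

/-- The softmax distribution maximizes the entropy-regularized linear functional. -/
lemma sum_regularized_le_softmax {A : Type*} [Fintype A] [Nonempty A] {κ : ℝ} (hκ : 0 < κ)
    {x p q : A → ℝ} (hp : ∀ a, p a = Real.exp (x a / κ) / ∑ a', Real.exp (x a' / κ))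
    (hp0 : ∀ a, 0 < p a) (hp1 : ∑ a, p a = 1) (hq : ∀ a, 0 ≤ q a) (hq1 : ∑ a, q a = 1) :
    ∑ a, q a * (x a - κ * Real.log (q a)) ≤ ∑ a, p a * (x a - κ * Real.log (p a)) := by
  set Z := ∑ a', Real.exp (x a' / κ)
  have hZ : 0 < Z := Finset.sum_pos (fun _ _ => Real.exp_pos _) Finset.univ_nonempty
  have hlog : ∀ a, x a = κ * Real.log (p a) + κ * Real.log Z := by
    intro a
    rw [hp a, Real.log_div (Real.exp_ne_zero _) hZ.ne', Real.log_exp]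
    field_simp
    ring
  have hR : ∑ a, p a * (x a - κ * Real.log (p a)) = κ * Real.log Z := by
    rw [Finset.sum_congr rfl fun a _ => show p a * (x a - κ * Real.log (p a)) =
      p a * (κ * Real.log Z) by rw [hlog a]; ring, ← Finset.sum_mul, hp1, one_mul]
  have hL : ∑ a, q a * (x a - κ * Real.log (q a)) =
      κ * Real.log Z + κ * (∑ a, q a * Real.log (p a) - ∑ a, q a * Real.log (q a)) := by
    rw [Finset.sum_congr rfl fun a _ => show q a * (x a - κ * Real.log (q a)) =
      q a * (κ * Real.log Z) + κ * (q a * Real.log (p a) - q a * Real.log (q a)) by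
        rw [hlog a]; ring, Finset.sum_add_distrib, ← Finset.sum_mul, hq1, one_mul,
      ← Finset.mul_sum, Finset.sum_sub_distrib]
  rw [hR, hL]
  have := mul_nonneg hκ.le (sub_nonneg.2 (sum_mul_log_le_sum_mul_log hp0 hp1 hq hq1))
  linarith

lemma weighted_sum_mem_Icc {ι : Type*} [Fintype ι] {w f : ι → ℝ} {m : ℝ}
    (hw : ∀ i, 0 ≤ w i) (hw1 : ∑ i, w i = 1) (hf : ∀ i, f i ∈ Set.Icc 0 m) :
    ∑ i, w i * f i ∈ Set.Icc 0 m := by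
  refine ⟨Finset.sum_nonneg fun i _ => mul_nonneg (hw i) (hf i).1, ?_⟩
  calc ∑ i, w i * f i ≤ ∑ i, w i * m :=
        Finset.sum_le_sum fun i _ => mul_le_mul_of_nonneg_left (hf i).2 (hw i)
    _ = m := by rw [← Finset.sum_mul, hw1, one_mul]

lemma clip_mem_Icc (x : ℝ) {m : ℝ} (hm : 0 ≤ m) : min (max x 0) m ∈ Set.Icc 0 m :=
  ⟨le_min (le_max_right _ _) hm, min_le_right _ _⟩

lemma le_clip_add_of_abs_sub_le {x y c m : ℝ} (h : |x - y| ≤ c) (hy : y ≤ m) :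
    y ≤ min (max (c + x) 0) m :=
  le_min (le_max_of_le_left (by linarith [(abs_le.1 h).1])) hy

lemma sub_le_clip_neg_add_of_abs_sub_le {x y c m : ℝ} (h : |x - y| ≤ c) (hy : y ≤ m) :
    y - 2 * c ≤ min (max (-c + x) 0) m :=
  le_min (le_max_of_le_left (by linarith [(abs_le.1 h).1]))
    (by linarith [(abs_nonneg _).trans h])

/-- One step of the recursion defining the clipped value functions. -/
lemma clipTripleAux_succ {S A : Type*} [Fintype S] [Fintype A]
    (Phat : ℕ → (S → ℝ) → S → A → ℝ) (r u β : ℕ → S → A → ℝ)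
    (Cr Cp Cd Bd κ lam : ℝ) (H n h : ℕ) (s : S) :
    ∃ Qd Qr Qu p : A → ℝ,
      (∀ a, Qd a = Bd * β h s a + min (max (Cd * β h s a +
        Phat h (fun s' => (ClipTripleAux Phat r u β Cr Cp Cd Bd κ lam H n (h + 1) s').1) s a) 0)
        (Bd * ((H : ℝ) - h))) ∧
      (∀ a, Qr a = r h s a + min (max (Cr * β h s a +
        Phat h (fun s' => (ClipTripleAux Phat r u β Cr Cp Cd Bd κ lam H n (h + 1) s').2.1) s a) 0)
        (((H : ℝ) - h) * (1 + κ * Real.log (Fintype.card A)))) ∧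
      (∀ a, Qu a = u h s a + min (max (-(Cp * β h s a) +
        Phat h (fun s' => (ClipTripleAux Phat r u β Cr Cp Cd Bd κ lam H n (h + 1) s').2.2) s a) 0)
        ((H : ℝ) - h)) ∧
      (∀ a, p a = Real.exp ((Qd a + Qr a + lam * Qu a) / κ)
        / ∑ a', Real.exp ((Qd a' + Qr a' + lam * Qu a') / κ)) ∧
      ClipTripleAux Phat r u β Cr Cp Cd Bd κ lam H (n + 1) h s =
        (∑ a, p a * Qd a, ∑ a, p a * (Qr a - κ * Real.log (p a)), ∑ a, p a * Qu a) :=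
  ⟨_, _, _, _, fun _ => rfl, fun _ => rfl, fun _ => rfl, fun _ => rfl, rfl⟩

/-- Ranges of the clipped value functions, and the lower bound on the composite value function
of the softmax policy by the pessimistic utility value of any policy `pol`. -/
lemma clipTripleAux_bounds {S A : Type*} [Fintype S] [Fintype A] [Nonempty A]
    {H : ℕ} {P : ℕ → S → A → S → ℝ}
    (hP : ∀ h s a, (∀ s', 0 ≤ P h s a s') ∧ ∑ s', P h s a s' = 1)
    {Phat : ℕ → (S → ℝ) → S → A → ℝ} {Cr Cp Cd Bd lam κ : ℝ}
    (hBd : 0 ≤ Bd) (hκ : 0 < κ) (hlam : 0 ≤ lam)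
    {r u β : ℕ → S → A → ℝ}
    (hr : ∀ h s a, r h s a ∈ Set.Icc (0 : ℝ) 1)
    (hu : ∀ h s a, u h s a ∈ Set.Icc (0 : ℝ) 1)
    (hβ : ∀ h s a, β h s a ∈ Set.Icc (0 : ℝ) 1)
    (haccR : ∀ h ∈ Finset.Icc 1 H, ∀ s a,
      |Phat h (fun s' => (ClipTripleV Phat r u β Cr Cp Cd Bd κ lam H (h + 1) s').2.1) s a
        - ∑ s', P h s a s' * (ClipTripleV Phat r u β Cr Cp Cd Bd κ lam H (h + 1) s').2.1|
          ≤ Cr * β h s a)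
    (haccU : ∀ h ∈ Finset.Icc 1 H, ∀ s a,
      |Phat h (fun s' => (ClipTripleV Phat r u β Cr Cp Cd Bd κ lam H (h + 1) s').2.2) s a
        - ∑ s', P h s a s' * (ClipTripleV Phat r u β Cr Cp Cd Bd κ lam H (h + 1) s').2.2|
          ≤ Cp * β h s a)
    (haccD : ∀ h ∈ Finset.Icc 1 H, ∀ s a,
      |Phat h (fun s' => (ClipTripleV Phat r u β Cr Cp Cd Bd κ lam H (h + 1) s').1) s a
        - ∑ s', P h s a s' * (ClipTripleV Phat r u β Cr Cp Cd Bd κ lam H (h + 1) s').1|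
          ≤ Cd * β h s a)
    {pol : ℕ → S → A → ℝ}
    (hpol : ∀ h s, (∀ a, 0 ≤ pol h s a) ∧ ∑ a, pol h s a = 1)
    (n h : ℕ) (hh : 1 ≤ h) (hn : h + n = H + 1) (s : S) :
    (ClipTripleAux Phat r u β Cr Cp Cd Bd κ lam H n h s).1 ∈ Set.Icc 0 (Bd * n) ∧
    (ClipTripleAux Phat r u β Cr Cp Cd Bd κ lam H n h s).2.1 ∈
      Set.Icc 0 (n * (1 + κ * Real.log (Fintype.card A))) ∧
    (ClipTripleAux Phat r u β Cr Cp Cd Bd κ lam H n h s).2.2 ∈ Set.Icc 0 (n : ℝ) ∧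
    lam * (Vaux P pol u 0 n h s - Vaux P pol (fun h s a => 2 * Cp * β h s a) 0 n h s) ≤
      (ClipTripleAux Phat r u β Cr Cp Cd Bd κ lam H n h s).1
      + (ClipTripleAux Phat r u β Cr Cp Cd Bd κ lam H n h s).2.1
      + lam * (ClipTripleAux Phat r u β Cr Cp Cd Bd κ lam H n h s).2.2 := by
  induction n generalizing h s with
  | zero => simp [ClipTripleAux, Vaux]
  | succ n ih =>
    have ih := ih (h + 1) (by omega) (by omega)
    have hmem : h ∈ Finset.Icc 1 H := Finset.mem_Icc.2 ⟨hh, by omega⟩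
    have haR := haccR h hmem s
    have haU := haccU h hmem s
    have haD := haccD h hmem s
    simp only [ClipTripleV, show H + 1 - (h + 1) = n by omega] at haR haU haD
    have hHn : (H : ℝ) - h = n := by
      have : (h : ℝ) + (n + 1) = H + 1 := by exact_mod_cast hn
      linarith
    obtain ⟨Qd, Qr, Qu, p, hQd, hQr, hQu, hp, hT⟩ :=
      clipTripleAux_succ Phat r u β Cr Cp Cd Bd κ lam H n h s
    rw [hT]
    rw [hHn] at hQd hQr hQu
    generalize hW : ClipTripleAux Phat r u β Cr Cp Cd Bd κ lam H n (h + 1) = W at *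
    set L := 1 + κ * Real.log (Fintype.card A) with hL
    have hlogc : 0 ≤ Real.log (Fintype.card A) := Real.log_natCast_nonneg _
    have hL0 : 0 ≤ L := by positivity
    have hZ : 0 < ∑ a', Real.exp ((Qd a' + Qr a' + lam * Qu a') / κ) :=
      Finset.sum_pos (fun _ _ => Real.exp_pos _) Finset.univ_nonempty
    have hp0 : ∀ a, 0 < p a := fun a => by rw [hp a]; exact div_pos (Real.exp_pos _) hZ
    have hp1 : ∑ a, p a = 1 := by
      simp only [hp]
      rw [← Finset.sum_div, div_self hZ.ne']
    have hp0' : ∀ a, 0 ≤ p a := fun a => (hp0 a).le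
    have hn0 : (0 : ℝ) ≤ n := n.cast_nonneg
    have hQdm : ∀ a, Qd a ∈ Set.Icc 0 (Bd * ((n + 1 : ℕ) : ℝ)) := fun a => by
      have h1 := clip_mem_Icc (Cd * β h s a + Phat h (fun s' => (W s').1) s a)
        (mul_nonneg hBd hn0)
      have h2 := mul_nonneg hBd (hβ h s a).1
      have h3 := mul_le_mul_of_nonneg_left (hβ h s a).2 hBd
      rw [hQd a]
      push_cast
      exact ⟨by linarith [h1.1], by linarith [h1.2]⟩
    have hQrm : ∀ a, Qr a ∈ Set.Icc 0 (1 + n * L) := fun a => by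
      have h1 := clip_mem_Icc (Cr * β h s a + Phat h (fun s' => (W s').2.1) s a)
        (mul_nonneg hn0 hL0)
      have h2 := hr h s a
      rw [hQr a]
      exact ⟨by linarith [h1.1, h2.1], by linarith [h1.2, h2.2]⟩
    have hQum : ∀ a, Qu a ∈ Set.Icc 0 ((n + 1 : ℕ) : ℝ) := fun a => by
      have h1 := clip_mem_Icc (-(Cp * β h s a) + Phat h (fun s' => (W s').2.2) s a) hn0
      have h2 := hu h s a
      rw [hQu a]
      push_cast
      exact ⟨by linarith [h1.1, h2.1], by linarith [h1.2, h2.2]⟩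
    have hVr : ∑ a, p a * (Qr a - κ * Real.log (p a)) =
        ∑ a, p a * Qr a - κ * ∑ a, p a * Real.log (p a) := by
      rw [Finset.mul_sum, ← Finset.sum_sub_distrib]
      exact Finset.sum_congr rfl fun a _ => by ring
    refine ⟨weighted_sum_mem_Icc hp0' hp1 hQdm, ?_, weighted_sum_mem_Icc hp0' hp1 hQum, ?_⟩
    · have h1 := weighted_sum_mem_Icc hp0' hp1 hQrm
      have h2 := mul_nonneg hκ.le (neg_nonneg.2 (sum_mul_log_nonpos hp0' hp1))
      have h3 := mul_le_mul_of_nonneg_left (neg_log_card_le_sum_mul_log hp0' hp1) hκ.le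
      simp only [hVr]
      push_cast
      exact ⟨by linarith [h1.1], by linarith [h1.2]⟩
    · obtain ⟨hq, hq1⟩ := hpol h s
      have hgibbs := sum_regularized_le_softmax hκ hp hp0 hp1 hq hq1
      have hsplit : ∑ a, p a * (Qd a + Qr a + lam * Qu a - κ * Real.log (p a)) =
          ∑ a, p a * Qd a + ∑ a, p a * (Qr a - κ * Real.log (p a))
            + lam * ∑ a, p a * Qu a := by
        rw [Finset.mul_sum, ← Finset.sum_add_distrib, ← Finset.sum_add_distrib]
        exact Finset.sum_congr rfl fun a _ => by ring
      have hsplit' : ∑ a, pol h s a * (Qd a + Qr a + lam * Qu a - κ * Real.log (pol h s a)) =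
          ∑ a, pol h s a * (Qd a + Qr a + lam * Qu a)
            - κ * ∑ a, pol h s a * Real.log (pol h s a) := by
        rw [Finset.mul_sum, ← Finset.sum_sub_distrib]
        exact Finset.sum_congr rfl fun a _ => by ring
      have hent := mul_nonneg hκ.le (neg_nonneg.2 (sum_mul_log_nonpos hq hq1))
      have hQ : ∀ a, lam * ((u h s a + ∑ s', P h s a s' * Vaux P pol u 0 n (h + 1) s')
          - (2 * Cp * β h s a + ∑ s', P h s a s' *
            Vaux P pol (fun h s a => 2 * Cp * β h s a) 0 n (h + 1) s'))
          ≤ Qd a + Qr a + lam * Qu a := by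
        intro a
        obtain ⟨hPa, hPa1⟩ := hP h s a
        have hd : ∑ s', P h s a s' * (W s').1 ≤ Qd a := by
          have := le_clip_add_of_abs_sub_le (haD a)
            (weighted_sum_mem_Icc hPa hPa1 fun s' => (ih s').1).2
          rw [hQd a]
          linarith [mul_nonneg hBd (hβ h s a).1]
        have hr' : ∑ s', P h s a s' * (W s').2.1 ≤ Qr a := by
          have := le_clip_add_of_abs_sub_le (haR a)
            (weighted_sum_mem_Icc hPa hPa1 fun s' => (ih s').2.1).2
          rw [hQr a]
          linarith [(hr h s a).1]
        have hu' : u h s a - 2 * Cp * β h s a + ∑ s', P h s a s' * (W s').2.2 ≤ Qu a := by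
          have := sub_le_clip_neg_add_of_abs_sub_le (haU a)
            (weighted_sum_mem_Icc hPa hPa1 fun s' => (ih s').2.2.1).2
          rw [hQu a]
          linarith
        have hnext := Finset.sum_le_sum fun s' (_ : s' ∈ Finset.univ) =>
          mul_le_mul_of_nonneg_left (ih s').2.2.2 (hPa s')
        have e1 : ∑ s', P h s a s' * (lam * (Vaux P pol u 0 n (h + 1) s'
            - Vaux P pol (fun h s a => 2 * Cp * β h s a) 0 n (h + 1) s')) =
            lam * (∑ s', P h s a s' * Vaux P pol u 0 n (h + 1) s' - ∑ s', P h s a s' *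
              Vaux P pol (fun h s a => 2 * Cp * β h s a) 0 n (h + 1) s') := by
          rw [← Finset.sum_sub_distrib, Finset.mul_sum]
          exact Finset.sum_congr rfl fun a _ => by ring
        have e2 : ∑ s', P h s a s' * ((W s').1 + (W s').2.1 + lam * (W s').2.2) =
            ∑ s', P h s a s' * (W s').1 + ∑ s', P h s a s' * (W s').2.1
              + lam * ∑ s', P h s a s' * (W s').2.2 := by
          rw [Finset.mul_sum, ← Finset.sum_add_distrib, ← Finset.sum_add_distrib]
          exact Finset.sum_congr rfl fun a _ => by ring
        rw [e1, e2] at hnext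
        linarith [mul_le_mul_of_nonneg_left hu' hlam]
      have hsum := Finset.sum_le_sum fun a (_ : a ∈ Finset.univ) =>
        mul_le_mul_of_nonneg_left (hQ a) (hq a)
      have hV : lam * (Vaux P pol u 0 (n + 1) h s
          - Vaux P pol (fun h s a => 2 * Cp * β h s a) 0 (n + 1) h s) =
          ∑ a, pol h s a * (lam * ((u h s a + ∑ s', P h s a s' * Vaux P pol u 0 n (h + 1) s')
            - (2 * Cp * β h s a + ∑ s', P h s a s' *
              Vaux P pol (fun h s a => 2 * Cp * β h s a) 0 n (h + 1) s'))) := by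
        simp only [Vaux]
        rw [← Finset.sum_sub_distrib, Finset.mul_sum]
        exact Finset.sum_congr rfl fun a _ => by ring
      rw [hV]
      linarith

/-- **Implicit safe-policy deployment trigger.**
If `C_λ ≥ 8H_κ²(B_†+1)/ξ`, `κ ≤ ξ²/(32H_κ²(B_†+1))`, the estimated transition operator `P̂`
is accurate on the clipped value functions of the composite softmax policy `π^{C_λ}`, and a
safe policy `π_sf` exists with `V^{π_sf,u}_{P,1}(s₁) − b ≥ ξ` and
`V^{π_sf,2C_pβ}_{P,1}(s₁) ≤ ξ/2`, then `V̲^{π^{C_λ},u}_1(s₁) ≥ b`. -/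
theorem implicit_safe_policy_trigger
    {S A : Type*} [Fintype S] [Fintype A] [Nonempty S] [Nonempty A]
    (H : ℕ) (hH : 1 ≤ H)
    (P : ℕ → S → A → S → ℝ)
    (hP : ∀ h s a, (∀ s', 0 ≤ P h s a s') ∧ ∑ s', P h s a s' = 1)
    (Phat : ℕ → (S → ℝ) → S → A → ℝ)
    (s₁ : S) (ξ b Cr Cp Cd Bd Clam κ : ℝ)
    (hξ : 0 < ξ) (hCr : 0 < Cr) (hCp : 0 < Cp) (hCd : 0 < Cd) (hBd : 0 ≤ Bd) (hκ : 0 < κ)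
    (hClam : Clam ≥ 8 * (H * (1 + κ * Real.log (Fintype.card A))) ^ 2 * (Bd + 1) / ξ)
    (hκle : κ ≤ ξ ^ 2 / (32 * (H * (1 + κ * Real.log (Fintype.card A))) ^ 2 * (Bd + 1)))
    (r u β : ℕ → S → A → ℝ)
    (hr : ∀ h s a, r h s a ∈ Set.Icc (0:ℝ) 1)
    (hu : ∀ h s a, u h s a ∈ Set.Icc (0:ℝ) 1)
    (hβ : ∀ h s a, β h s a ∈ Set.Icc (0:ℝ) 1)
    (haccR : ∀ h ∈ Finset.Icc 1 H, ∀ s a,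
      |Phat h (fun s' => (ClipTripleV Phat r u β Cr Cp Cd Bd κ Clam H (h + 1) s').2.1) s a
        - ∑ s', P h s a s' * (ClipTripleV Phat r u β Cr Cp Cd Bd κ Clam H (h + 1) s').2.1|
          ≤ Cr * β h s a)
    (haccU : ∀ h ∈ Finset.Icc 1 H, ∀ s a,
      |Phat h (fun s' => (ClipTripleV Phat r u β Cr Cp Cd Bd κ Clam H (h + 1) s').2.2) s a
        - ∑ s', P h s a s' * (ClipTripleV Phat r u β Cr Cp Cd Bd κ Clam H (h + 1) s').2.2|
          ≤ Cp * β h s a)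
    (haccD : ∀ h ∈ Finset.Icc 1 H, ∀ s a,
      |Phat h (fun s' => (ClipTripleV Phat r u β Cr Cp Cd Bd κ Clam H (h + 1) s').1) s a
        - ∑ s', P h s a s' * (ClipTripleV Phat r u β Cr Cp Cd Bd κ Clam H (h + 1) s').1|
          ≤ Cd * β h s a)
    (πsf : ℕ → S → A → ℝ)
    (hπsf : ∀ h s, (∀ a, 0 ≤ πsf h s a) ∧ ∑ a, πsf h s a = 1)
    (hπsf_safe : Vval H P πsf u 0 1 s₁ - b ≥ ξ)
    (hπsf_conf : Vval H P πsf (fun h s a => 2 * Cp * β h s a) 0 1 s₁ ≤ ξ / 2) :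
    (ClipTripleV Phat r u β Cr Cp Cd Bd κ Clam H 1 s₁).2.2 ≥ b := by
  have hlogc : 0 ≤ Real.log (Fintype.card A) := Real.log_natCast_nonneg _
  have hH' : (1 : ℝ) ≤ H := by exact_mod_cast hH
  have hL1 : 1 ≤ 1 + κ * Real.log (Fintype.card A) := by
    linarith [mul_nonneg hκ.le hlogc]
  set L := 1 + κ * Real.log (Fintype.card A) with hL
  have hK : (H : ℝ) ≤ H * L := le_mul_of_one_le_right (by linarith) hL1
  have hlam : 0 < Clam :=
    lt_of_lt_of_le (div_pos (by positivity) hξ) hClam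
  obtain ⟨hd, hr', -, hmain⟩ := clipTripleAux_bounds hP hBd hκ hlam.le hr hu hβ haccR haccU haccD
    hπsf H 1 le_rfl (by omega) s₁
  simp only [Vval, ClipTripleV, Nat.add_sub_cancel] at hπsf_safe hπsf_conf ⊢
  have hsafe := mul_le_mul_of_nonneg_left
    (show b + ξ / 2 ≤ Vaux P πsf u 0 H 1 s₁
      - Vaux P πsf (fun h s a => 2 * Cp * β h s a) 0 H 1 s₁ by linarith) hlam.le
  have hbig : 8 * (H * L) ^ 2 * (Bd + 1) ≤ Clam * ξ := (div_le_iff₀ hξ).1 hClam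
  have hsq : (H : ℝ) * L ≤ (H * L) ^ 2 := le_self_pow₀ (by linarith) two_ne_zero
  have hBH : Bd * H + H * L ≤ (H * L) ^ 2 * (Bd + 1) := by
    nlinarith [mul_le_mul_of_nonneg_left (hK.trans hsq) hBd]
  have hpos : 0 ≤ (H * L) ^ 2 * (Bd + 1) := by positivity
  refine le_of_mul_le_mul_left ?_ hlam
  linarith [hd.2, hr'.2]
end

section
/- Logarithmic bound on the number of unconfident iterations (MDP). Let K ≥ 1, d ≥ 2, H ≥ 1, δ ∈ (0,1], ξ > 0, C_p > 0. Let φ: S×A → ℝ^d with ‖φ(s,a)‖₂ ≤ 1 for all (s,a). Let (s_h^(k), a_h^(k)) ∈ S×A be given for k ∈ {1,…,K} and h ∈ {1,…,H}, set Λ_h^(k) = I_d + Σ_{i<k} φ(s_h^(i),a_h^(i))·φ(s_h^(i),a_h^(i))ᵀ and β^(k)_h(s,a) = ‖φ(s,a)‖_{(Λ_h^(k))⁻¹}. Let π_sf, π^(1),…,π^(K) be policies, define U = {k ∈ {1,…,K} : V^{π_sf,β^(k)}_{P,1}(s₁) > ξ/(4C_p)}, and assume π^(k) = π_sf for every k ∈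 U. Assume also Σ_{k=1}^K Σ_{h=1}^H Σ_{s,a} ω^{π^(k)}_h(s,a)·β^(k)_h(s,a)² ≤ 2·Σ_{k=1}^K Σ_{h=1}^H β^(k)_h(s_h^(k),a_h^(k))² + 4H·ln(2KH/δ). Then |U| ≤ 64·C_p²·H²·d·ξ⁻²·ln(2KH/δ). -/
open Matrix

/-- Occupancy measure of policy `pol` started at `s₁`:
`occ P pol s₁ 1 s a = 1{s=s₁}·pol₁(a|s₁)` and
`occ P pol s₁ (h+1) s' a' = Σ_{s,a} occ P pol s₁ h s a · P_h(s'|s,a) · pol_{h+1}(a'|s')`. -/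
noncomputable def occ {S A : Type*} [Fintype S] [Fintype A] [DecidableEq S]
    (P : ℕ → S → A → S → ℝ) (pol : ℕ → S → A → ℝ) (s₁ : S) : ℕ → S → A → ℝ
  | 0 => fun _ _ => 0
  | 1 => fun s a => (if s = s₁ then (1 : ℝ) else 0) * pol 1 s a
  | h + 2 => fun s' a' =>
      ∑ s, ∑ a, occ P pol s₁ (h + 1) s a * P (h + 1) s a s' * pol (h + 2) s' a'

open scoped Classical

section EllipticalPotential

variable {n : Type*} [Fintype n] [DecidableEq n]

lemma det_add_vecMulVec_self_s15 {M : Matrix n n ℝ} (hM : IsUnit M.det) (v : n → ℝ) :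
    (M + vecMulVec v v).det = M.det * (1 + v ⬝ᵥ M⁻¹ *ᵥ v) := by
  have h := det_add_replicateCol_mul_replicateRow (ι := Unit) hM v v
  rw [← vecMulVec_eq Unit] at h
  rw [h, det_unique (n := Unit)]
  simp [Matrix.mul_assoc, Matrix.mul_apply, dotProduct, mulVec]

/-- The Sherman–Morrison formula for a symmetric rank-one update. -/
lemma inv_add_vecMulVec_self {M : Matrix n n ℝ} (hM : M.PosDef) (v : n → ℝ) :
    (M + vecMulVec v v)⁻¹ =
      M⁻¹ - (1 + v ⬝ᵥ M⁻¹ *ᵥ v)⁻¹ • vecMulVec (M⁻¹ *ᵥ v) (M⁻¹ *ᵥ v) := by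
  have hdet : IsUnit M.det := hM.det_pos.ne'.isUnit
  have hx : 0 ≤ v ⬝ᵥ M⁻¹ *ᵥ v := hM.inv.posSemidef.dotProduct_mulVec_nonneg v
  have hsymm : v ᵥ* M⁻¹ = M⁻¹ *ᵥ v := by
    rw [← mulVec_transpose]
    congr 1
    exact hM.inv.isHermitian.eq
  apply inv_eq_right_inv
  rw [add_mul, mul_sub, mul_sub, mul_nonsing_inv _ hdet, mul_smul_comm, mul_smul_comm,
    mul_vecMulVec, mulVec_mulVec, mul_nonsing_inv _ hdet, one_mulVec, vecMulVec_mul, hsymm,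
    vecMulVec_mul_vecMulVec, vecMulVec_smul]
  ext i j
  simp only [Matrix.add_apply, Matrix.sub_apply, Matrix.smul_apply, smul_eq_mul]
  field_simp
  ring

omit [DecidableEq n] in
lemma dotProduct_sq_le (v w : n → ℝ) : (v ⬝ᵥ w) ^ 2 ≤ (v ⬝ᵥ v) * (w ⬝ᵥ w) := by
  simpa only [dotProduct, sq] using Finset.sum_mul_sq_le_sq_mul_sq Finset.univ v w

lemma dotProduct_inv_mulVec_le_one {B : Matrix n n ℝ} (hB : B.PosSemidef) {v : n → ℝ}
    (hv : v ⬝ᵥ v ≤ 1) : v ⬝ᵥ (1 + B)⁻¹ *ᵥ v ≤ 1 := by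
  have hM : (1 + B).PosDef := PosDef.one.add_posSemidef hB
  set w := (1 + B)⁻¹ *ᵥ v with hw
  have hv' : v = w + B *ᵥ w := by
    calc v = (1 + B) *ᵥ w := by
          rw [hw, mulVec_mulVec, mul_nonsing_inv _ hM.det_pos.ne'.isUnit, one_mulVec]
      _ = w + B *ᵥ w := by rw [add_mulVec, one_mulVec]
  have hle : w ⬝ᵥ w ≤ v ⬝ᵥ w := by
    have h0 : 0 ≤ w ⬝ᵥ B *ᵥ w := hB.dotProduct_mulVec_nonneg w
    have h1 : v ⬝ᵥ w = w ⬝ᵥ w + w ⬝ᵥ B *ᵥ w := by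
      rw [dotProduct_comm, ← dotProduct_add, ← hv']
    linarith
  have hw0 : 0 ≤ w ⬝ᵥ w := dotProduct_self_star_nonneg w
  nlinarith [dotProduct_sq_le v w, mul_le_mul_of_nonneg_right hv hw0]

/-- The increment of `log det M - tr M⁻¹` under a rank-one update by a vector of norm at most one
dominates the squared elliptical norm of this vector. -/
lemma dotProduct_inv_mulVec_le_potential_sub {M : Matrix n n ℝ} (hM : M.PosDef) {v : n → ℝ}
    (hv : v ⬝ᵥ v ≤ 1) :
    v ⬝ᵥ M⁻¹ *ᵥ v ≤ (Real.log (M + vecMulVec v v).det - (M + vecMulVec v v)⁻¹.trace)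
      - (Real.log M.det - M⁻¹.trace) := by
  have hx : 0 ≤ v ⬝ᵥ M⁻¹ *ᵥ v := hM.inv.posSemidef.dotProduct_mulVec_nonneg v
  rw [inv_add_vecMulVec_self hM, det_add_vecMulVec_self_s15 hM.det_pos.ne'.isUnit, trace_sub,
    trace_smul, trace_vecMulVec, Real.log_mul hM.det_pos.ne' (by positivity), smul_eq_mul]
  set w := M⁻¹ *ᵥ v
  set x := v ⬝ᵥ w
  have hlog : 1 - (1 + x)⁻¹ ≤ Real.log (1 + x) :=
    Real.one_sub_inv_le_log_of_pos (by positivity)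
  have hw0 : 0 ≤ w ⬝ᵥ w := dotProduct_self_star_nonneg w
  have hw : x ^ 2 ≤ w ⬝ᵥ w :=
    (dotProduct_sq_le v w).trans (mul_le_of_le_one_left hw0 hv)
  have htr : (1 + x)⁻¹ * x ^ 2 ≤ (1 + x)⁻¹ * (w ⬝ᵥ w) := by gcongr
  have hid : x = 1 - (1 + x)⁻¹ + (1 + x)⁻¹ * x ^ 2 := by
    field_simp
    ring
  linarith

lemma log_det_le_of_trace {M : Matrix n n ℝ} (hM : M.PosDef) {t : ℝ} (ht : 0 < t) :
    Real.log M.det ≤ M.trace / t - Fintype.card n + Fintype.card n * Real.log t := by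
  have hdet := hM.isHermitian.det_eq_prod_eigenvalues
  have htr := hM.isHermitian.trace_eq_sum_eigenvalues
  simp only [RCLike.ofReal_real_eq_id, id] at hdet htr
  rw [hdet, htr, Real.log_prod fun i _ => (hM.eigenvalues_pos i).ne', Finset.sum_div]
  have hi : ∀ i, Real.log (hM.isHermitian.eigenvalues i) ≤
      hM.isHermitian.eigenvalues i / t - 1 + Real.log t := fun i => by
    have hpos := hM.eigenvalues_pos i
    have := Real.log_le_sub_one_of_pos (div_pos hpos ht)
    rw [Real.log_div hpos.ne' ht.ne'] at this
    linarith
  refine (Finset.sum_le_sum fun i _ => hi i).trans_eq ?_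
  simp [Finset.sum_add_distrib, Finset.sum_sub_distrib]

/-- The regularized Gram matrix of the vectors `v 1, …, v (k - 1)`. -/
def regGram (v : ℕ → n → ℝ) (k : ℕ) : Matrix n n ℝ :=
  1 + ∑ i ∈ Finset.Ico 1 k, vecMulVec (v i) (v i)

omit [DecidableEq n] in
lemma posSemidef_sum_vecMulVec_self (v : ℕ → n → ℝ) (s : Finset ℕ) :
    (∑ i ∈ s, vecMulVec (v i) (v i)).PosSemidef :=
  posSemidef_sum s fun i _ => by simpa using posSemidef_vecMulVec_self_star (v i)

lemma regGram_posDef (v : ℕ → n → ℝ) (k : ℕ) : (regGram v k).PosDef :=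
  PosDef.one.add_posSemidef (posSemidef_sum_vecMulVec_self v _)

omit [Fintype n] in
lemma regGram_succ (v : ℕ → n → ℝ) {k : ℕ} (hk : 1 ≤ k) :
    regGram v (k + 1) = regGram v k + vecMulVec (v k) (v k) := by
  rw [regGram, regGram, Finset.sum_Ico_succ_top hk, add_assoc]

lemma sum_dotProduct_inv_mulVec_le_card {v : ℕ → n → ℝ} (hv : ∀ k, v k ⬝ᵥ v k ≤ 1) (K : ℕ) :
    ∑ k ∈ Finset.Icc 1 K, v k ⬝ᵥ (regGram v k)⁻¹ *ᵥ v k ≤ K := by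
  refine (Finset.sum_le_sum fun k _ =>
    dotProduct_inv_mulVec_le_one (posSemidef_sum_vecMulVec_self v _) (hv k)).trans_eq ?_
  simp

lemma sum_dotProduct_inv_mulVec_le_potential {v : ℕ → n → ℝ} (hv : ∀ k, v k ⬝ᵥ v k ≤ 1)
    (K : ℕ) :
    ∑ k ∈ Finset.Icc 1 K, v k ⬝ᵥ (regGram v k)⁻¹ *ᵥ v k ≤
      Real.log (regGram v (K + 1)).det - (regGram v (K + 1))⁻¹.trace + Fintype.card n := by
  induction K with
  | zero => simp [regGram]
  | succ K ih =>
    rw [Finset.sum_Icc_succ_top (by lia), regGram_succ v (k := K + 1) (by lia)]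
    have := dotProduct_inv_mulVec_le_potential_sub (regGram_posDef v (K + 1)) (hv (K + 1))
    linarith

lemma trace_regGram_le {v : ℕ → n → ℝ} (hv : ∀ k, v k ⬝ᵥ v k ≤ 1) (K : ℕ) :
    (regGram v (K + 1)).trace ≤ Fintype.card n + K := by
  simp only [regGram, trace_add, trace_one, trace_sum, trace_vecMulVec]
  gcongr
  refine (Finset.sum_le_sum fun k _ => hv k).trans_eq ?_
  simp

lemma sum_dotProduct_inv_mulVec_le_card_mul_log {v : ℕ → n → ℝ} (hv : ∀ k, v k ⬝ᵥ v k ≤ 1)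
    (K : ℕ) (hn : 0 < Fintype.card n) :
    ∑ k ∈ Finset.Icc 1 K, v k ⬝ᵥ (regGram v k)⁻¹ *ᵥ v k ≤
      Fintype.card n * (Real.log (1 + K / Fintype.card n) + 1) := by
  have hd : (0 : ℝ) < Fintype.card n := by exact_mod_cast hn
  have ht : (0 : ℝ) < 1 + K / Fintype.card n := by positivity
  have hdiv : (regGram v (K + 1)).trace / (1 + K / Fintype.card n) ≤ Fintype.card n := by
    rw [div_le_iff₀ ht]
    refine (trace_regGram_le hv K).trans_eq ?_
    field_simp
  have htr : 0 ≤ (regGram v (K + 1))⁻¹.trace :=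
    (regGram_posDef v (K + 1)).inv.posSemidef.trace_nonneg
  linarith [sum_dotProduct_inv_mulVec_le_potential hv K,
    log_det_le_of_trace (regGram_posDef v (K + 1)) ht]

lemma log_ten_ge : (2.2 : ℝ) ≤ Real.log 10 := by
  have h : Real.exp 11 ≤ (10 : ℝ) ^ 5 := by
    rw [show (11 : ℝ) = (11 : ℕ) * 1 by norm_num, Real.exp_nat_mul]
    calc Real.exp 1 ^ 11 ≤ 2.7182818286 ^ 11 := by gcongr; exact Real.exp_one_lt_d9.le
      _ ≤ 10 ^ 5 := by norm_num
  have := (Real.le_log_iff_exp_le (by positivity)).2 h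
  rw [Real.log_pow] at this
  norm_num at this ⊢
  linarith

lemma natCast_le_mul_log_two_mul {K d : ℕ} (hK : 1 ≤ K) (hd : 2 ≤ d)
    (hKd : (K : ℝ) ≤ 2.2 * d) : (K : ℝ) ≤ d * Real.log (2 * K) := by
  have hd' : (2 : ℝ) ≤ d := by exact_mod_cast hd
  have h2 := Real.log_two_gt_d9
  obtain hK5 | hK5 := lt_or_ge K 5
  · have hlog : (K : ℝ) ≤ 2 * Real.log (2 * K) := by
      have h4 : Real.log 4 = 2 * Real.log 2 := by
        rw [show (4 : ℝ) = 2 ^ 2 by norm_num, Real.log_pow]; norm_num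
      have h6 : Real.log 4 ≤ Real.log 6 := Real.log_le_log (by norm_num) (by norm_num)
      have h8 : Real.log 8 = 3 * Real.log 2 := by
        rw [show (8 : ℝ) = 2 ^ 3 by norm_num, Real.log_pow]; norm_num
      have h36 : 5 * Real.log 2 ≤ 2 * Real.log 6 := by
        have : Real.log (2 ^ 5) ≤ Real.log (6 ^ 2) :=
          Real.log_le_log (by norm_num) (by norm_num)
        simpa only [Real.log_pow, Nat.cast_ofNat] using this
      interval_cases K <;> norm_num <;> linarith
    have h0 : 0 ≤ Real.log (2 * K) :=
      Real.log_nonneg (by have : (1 : ℝ) ≤ K := by exact_mod_cast hK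
                          linarith)
    nlinarith
  · have hK' : (5 : ℝ) ≤ K := by exact_mod_cast hK5
    have : Real.log 10 ≤ Real.log (2 * K) := Real.log_le_log (by norm_num) (by linarith)
    nlinarith [log_ten_ge]

lemma log_one_add_add_one_le {u : ℝ} (hu : 2.2 ≤ u) :
    Real.log (1 + u) + 1 ≤ Real.log (4 * u) := by
  have hu0 : 0 < u := by linarith
  have h : Real.log (1 + u) + 1 = Real.log ((1 + u) * Real.exp 1) := by
    rw [Real.log_mul (by positivity) (Real.exp_pos _).ne', Real.log_exp]
  rw [h]
  refine Real.log_le_log (by positivity) ?_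
  nlinarith [Real.exp_one_lt_d9]

/-- A sharp elliptical potential lemma. -/
lemma sum_dotProduct_inv_mulVec_le_mul_log_two_mul {d K : ℕ} (hd : 2 ≤ d) (hK : 1 ≤ K)
    {v : ℕ → Fin d → ℝ} (hv : ∀ k, v k ⬝ᵥ v k ≤ 1) :
    ∑ k ∈ Finset.Icc 1 K, v k ⬝ᵥ (regGram v k)⁻¹ *ᵥ v k ≤ d * Real.log (2 * K) := by
  have hd' : (2 : ℝ) ≤ d := by exact_mod_cast hd
  have hK' : (1 : ℝ) ≤ K := by exact_mod_cast hK
  obtain hKd | hKd := le_total (K : ℝ) (2.2 * d)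
  · exact (sum_dotProduct_inv_mulVec_le_card hv K).trans (natCast_le_mul_log_two_mul hK hd hKd)
  · have h := sum_dotProduct_inv_mulVec_le_card_mul_log hv K (by simp; lia)
    rw [Fintype.card_fin] at h
    refine h.trans ?_
    gcongr
    refine (log_one_add_add_one_le ((le_div_iff₀ (by linarith)).2 hKd)).trans ?_
    have hK0 : (0 : ℝ) < K := by linarith
    have hd0 : (0 : ℝ) < d := by linarith
    refine Real.log_le_log (by positivity) ?_
    rw [mul_div_assoc', div_le_iff₀ (by linarith)]
    nlinarith

end EllipticalPotential

section Occupancy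

variable {S A : Type*} [Fintype S] [Fintype A] [DecidableEq S]

/-- State marginal of the occupancy measure, with steps counted from `0`. -/
noncomputable def stateOcc (P : ℕ → S → A → S → ℝ) (pol : ℕ → S → A → ℝ) (s₁ : S) :
    ℕ → S → ℝ
  | 0 => fun s => if s = s₁ then 1 else 0
  | h + 1 => fun s' => ∑ s, ∑ a, occ P pol s₁ (h + 1) s a * P (h + 1) s a s'

variable {P : ℕ → S → A → S → ℝ} {pol : ℕ → S → A → ℝ} (s₁ : S)

lemma occ_succ (h : ℕ) (s : S) (a : A) :
    occ P pol s₁ (h + 1) s a = stateOcc P pol s₁ h s * pol (h + 1) s a := by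
  cases h with
  | zero => simp [occ, stateOcc]
  | succ h => simp [occ, stateOcc, Finset.sum_mul]

lemma stateOcc_nonneg
    (hP : ∀ h s a, (∀ s', 0 ≤ P h s a s') ∧ ∑ s', P h s a s' = 1)
    (hpol : ∀ h s, (∀ a, 0 ≤ pol h s a) ∧ ∑ a, pol h s a = 1)
    (h : ℕ) (s : S) : 0 ≤ stateOcc P pol s₁ h s := by
  induction h generalizing s with
  | zero => simp only [stateOcc]; positivity
  | succ h ih =>
    refine Finset.sum_nonneg fun s' _ => Finset.sum_nonneg fun a _ => ?_
    rw [occ_succ]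
    exact mul_nonneg (mul_nonneg (ih s') ((hpol _ _).1 a)) ((hP _ _ _).1 _)

lemma occ_nonneg
    (hP : ∀ h s a, (∀ s', 0 ≤ P h s a s') ∧ ∑ s', P h s a s' = 1)
    (hpol : ∀ h s, (∀ a, 0 ≤ pol h s a) ∧ ∑ a, pol h s a = 1)
    (h : ℕ) (s : S) (a : A) : 0 ≤ occ P pol s₁ h s a := by
  cases h with
  | zero => simp [occ]
  | succ h =>
    rw [occ_succ]
    exact mul_nonneg (stateOcc_nonneg s₁ hP hpol h s) ((hpol _ _).1 a)

lemma sum_occ_succ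
    (hpol : ∀ h s, (∀ a, 0 ≤ pol h s a) ∧ ∑ a, pol h s a = 1)
    (h : ℕ) :
    ∑ s, ∑ a, occ P pol s₁ (h + 1) s a = ∑ s, stateOcc P pol s₁ h s := by
  simp [occ_succ, ← Finset.mul_sum, hpol]

lemma sum_stateOcc
    (hP : ∀ h s a, (∀ s', 0 ≤ P h s a s') ∧ ∑ s', P h s a s' = 1)
    (hpol : ∀ h s, (∀ a, 0 ≤ pol h s a) ∧ ∑ a, pol h s a = 1)
    (h : ℕ) : ∑ s, stateOcc P pol s₁ h s = 1 := by
  induction h with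
  | zero => simp [stateOcc]
  | succ h ih =>
    refine Eq.trans ?_ ((sum_occ_succ s₁ hpol h).trans ih)
    simp only [stateOcc]
    rw [Finset.sum_comm]
    refine Finset.sum_congr rfl fun s _ => ?_
    rw [Finset.sum_comm]
    simp [← Finset.mul_sum, hP]

/-- Expected reward-to-go in terms of occupancy measures. -/
lemma sum_stateOcc_mul_Vaux (g : ℕ → S → A → ℝ) (n h : ℕ) :
    ∑ s, stateOcc P pol s₁ h s * Vaux P pol g 0 n (h + 1) s =
      ∑ j ∈ Finset.Ico (h + 1) (h + 1 + n), ∑ s, ∑ a, occ P pol s₁ j s a * g j s a := by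
  induction n generalizing h with
  | zero => simp [Vaux]
  | succ n ih =>
    rw [Finset.sum_eq_sum_Ico_succ_bot (by lia), show h + 1 + (n + 1) = h + 1 + 1 + n by ring,
      ← ih (h + 1)]
    have hnext : ∑ s', stateOcc P pol s₁ (h + 1) s' * Vaux P pol g 0 n (h + 1 + 1) s' =
        ∑ s, ∑ a, occ P pol s₁ (h + 1) s a *
          ∑ s', P (h + 1) s a s' * Vaux P pol g 0 n (h + 1 + 1) s' := by
      simp only [stateOcc, Finset.sum_mul, Finset.mul_sum]
      rw [Finset.sum_comm]
      refine Finset.sum_congr rfl fun s _ => ?_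
      rw [Finset.sum_comm]
      simp only [mul_assoc]
    rw [hnext, ← Finset.sum_add_distrib]
    refine Finset.sum_congr rfl fun s _ => ?_
    rw [← Finset.sum_add_distrib]
    simp only [Vaux, Finset.mul_sum (s := (Finset.univ : Finset A)), zero_mul, sub_zero]
    refine Finset.sum_congr rfl fun a _ => ?_
    rw [occ_succ]
    ring

lemma Vval_one_eq_sum_occ (g : ℕ → S → A → ℝ) (H : ℕ) :
    Vval H P pol g 0 1 s₁ =
      ∑ h ∈ Finset.Icc 1 H, ∑ s, ∑ a, occ P pol s₁ h s a * g h s a := by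
  have h := sum_stateOcc_mul_Vaux (P := P) (pol := pol) s₁ g H 0
  simp only [stateOcc, ite_mul, one_mul, zero_mul, Finset.sum_ite_eq',
    Finset.mem_univ, if_true, zero_add] at h
  rw [Vval, Nat.add_sub_cancel, h, add_comm 1 H]
  rfl

lemma Vval_sq_le
    (hP : ∀ h s a, (∀ s', 0 ≤ P h s a s') ∧ ∑ s', P h s a s' = 1)
    (hpol : ∀ h s, (∀ a, 0 ≤ pol h s a) ∧ ∑ a, pol h s a = 1)
    (g : ℕ → S → A → ℝ) (H : ℕ) :
    Vval H P pol g 0 1 s₁ ^ 2 ≤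
      H * ∑ h ∈ Finset.Icc 1 H, ∑ s, ∑ a, occ P pol s₁ h s a * g h s a ^ 2 := by
  have hmass : ∑ h ∈ Finset.Icc 1 H, ∑ s, ∑ a, occ P pol s₁ h s a = H := by
    have hone : ∀ h ∈ Finset.Icc 1 H, ∑ s, ∑ a, occ P pol s₁ h s a = 1 := fun h hh => by
      obtain ⟨j, rfl⟩ := Nat.exists_eq_add_of_le' (Finset.mem_Icc.1 hh).1
      rw [sum_occ_succ s₁ hpol, sum_stateOcc s₁ hP hpol]
    rw [Finset.sum_congr rfl hone]
    simp
  rw [Vval_one_eq_sum_occ, ← hmass]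
  simp only [← Finset.sum_product']
  refine Finset.sum_sq_le_sum_mul_sum_of_sq_le_mul _ (fun i _ => occ_nonneg s₁ hP hpol _ _ _)
    (fun i _ => mul_nonneg (occ_nonneg s₁ hP hpol _ _ _) (sq_nonneg _)) fun i _ => le_of_eq ?_
  ring

end Occupancy

/-- **Logarithmic bound on the number of unconfident iterations (MDP).**
If the safe policy is deployed on every episode where its expected bonus exceeds `ξ/(4C_p)`,
then under the good event, `|U| ≤ 64·C_p²·H²·d·ξ⁻²·ln(2KH/δ)`. -/
theorem log_bound_unconfident_iterations_mdp
    {S A : Type*} [Fintype S] [Fintype A] [DecidableEq S] [Nonempty S] [Nonempty A]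
    (K d H : ℕ) (hK : 1 ≤ K) (hd : 2 ≤ d) (hH : 1 ≤ H)
    (δ ξ Cp : ℝ) (hδ : δ ∈ Set.Ioc (0:ℝ) 1) (hξ : 0 < ξ) (hCp : 0 < Cp)
    (P : ℕ → S → A → S → ℝ)
    (hP : ∀ h s a, (∀ s', 0 ≤ P h s a s') ∧ ∑ s', P h s a s' = 1)
    (s₁ : S)
    (φ : S → A → Fin d → ℝ)
    (hφ : ∀ s a, Real.sqrt (∑ i, φ s a i ^ 2) ≤ 1)
    (sk : ℕ → ℕ → S) (ak : ℕ → ℕ → A)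
    (Λ : ℕ → ℕ → Matrix (Fin d) (Fin d) ℝ)
    (hΛ : ∀ k h, Λ k h = 1 + ∑ i ∈ Finset.Ico 1 k,
      vecMulVec (φ (sk i h) (ak i h)) (φ (sk i h) (ak i h)))
    (β : ℕ → ℕ → S → A → ℝ)
    (hβ : ∀ k h s a, β k h s a = Real.sqrt (φ s a ⬝ᵥ (Λ k h)⁻¹.mulVec (φ s a)))
    (πsf : ℕ → S → A → ℝ)
    (hπsf : ∀ h s, (∀ a, 0 ≤ πsf h s a) ∧ ∑ a, πsf h s a = 1)
    (π : ℕ → ℕ → S → A → ℝ)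
    (hπ : ∀ k ∈ Finset.Icc 1 K, ∀ h s, (∀ a, 0 ≤ π k h s a) ∧ ∑ a, π k h s a = 1)
    (U : Finset ℕ)
    (hU : U = (Finset.Icc 1 K).filter
      (fun k => ξ / (4 * Cp) < Vval H P πsf (β k) 0 1 s₁))
    (hdeploy : ∀ k ∈ U, π k = πsf)
    (hgood : ∑ k ∈ Finset.Icc 1 K, ∑ h ∈ Finset.Icc 1 H, ∑ s, ∑ a,
        occ P (π k) s₁ h s a * β k h s a ^ 2
      ≤ 2 * ∑ k ∈ Finset.Icc 1 K, ∑ h ∈ Finset.Icc 1 H, β k h (sk k h) (ak k h) ^ 2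
        + 4 * H * Real.log (2 * K * H / δ)) :
    (U.card : ℝ) ≤ 64 * Cp ^ 2 * H ^ 2 * d * ξ⁻¹ ^ 2 * Real.log (2 * K * H / δ) := by
  have hv : ∀ h k, φ (sk k h) (ak k h) ⬝ᵥ φ (sk k h) (ak k h) ≤ 1 := fun h k => by
    simpa [dotProduct, sq] using hφ (sk k h) (ak k h)
  have hK' : (1 : ℝ) ≤ K := by exact_mod_cast hK
  have hH' : (1 : ℝ) ≤ H := by exact_mod_cast hH
  have hd' : (2 : ℝ) ≤ d := by exact_mod_cast hd
  have hΛ' : ∀ k h, Λ k h = regGram (fun i => φ (sk i h) (ak i h)) k := hΛ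
  set L := Real.log (2 * K * H / δ)
  have hKL : Real.log (2 * K) ≤ L := by
    refine Real.log_le_log (by positivity) ?_
    rw [le_div_iff₀ hδ.1]
    gcongr
    exact hδ.2.trans hH'
  have hL : 0 ≤ L := (Real.log_nonneg (by linarith)).trans hKL
  have hpotential : ∀ h, ∑ k ∈ Finset.Icc 1 K, β k h (sk k h) (ak k h) ^ 2 ≤ d * L := fun h => by
    refine le_trans (le_of_eq ?_) ((sum_dotProduct_inv_mulVec_le_mul_log_two_mul hd hK
      (hv h)).trans (by gcongr))
    refine Finset.sum_congr rfl fun k _ => ?_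
    rw [hβ, hΛ', Real.sq_sqrt]
    exact (regGram_posDef _ k).inv.posSemidef.dotProduct_mulVec_nonneg _
  have hsum : ∑ k ∈ Finset.Icc 1 K, ∑ h ∈ Finset.Icc 1 H, β k h (sk k h) (ak k h) ^ 2
      ≤ H * (d * L) := by
    rw [Finset.sum_comm]
    refine (Finset.sum_le_sum fun h _ => hpotential h).trans_eq ?_
    simp
  have hUsub : U ⊆ Finset.Icc 1 K := hU ▸ Finset.filter_subset _ _
  have hlower : ∀ k ∈ U, (ξ / (4 * Cp)) ^ 2 ≤
      H * ∑ h ∈ Finset.Icc 1 H, ∑ s, ∑ a, occ P (π k) s₁ h s a * β k h s a ^ 2 := fun k hk => by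
    rw [hdeploy k hk]
    refine le_trans ?_ (Vval_sq_le s₁ hP hπsf (β k) H)
    rw [hU, Finset.mem_filter] at hk
    exact pow_le_pow_left₀ (by positivity) hk.2.le 2
  have hcard : U.card * (ξ / (4 * Cp)) ^ 2 ≤ H * ∑ k ∈ Finset.Icc 1 K, ∑ h ∈ Finset.Icc 1 H,
      ∑ s, ∑ a, occ P (π k) s₁ h s a * β k h s a ^ 2 := by
    rw [← nsmul_eq_mul]
    refine (Finset.card_nsmul_le_sum U _ _ hlower).trans ?_
    rw [← Finset.mul_sum]
    refine mul_le_mul_of_nonneg_left ?_ (by positivity)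
    refine Finset.sum_le_sum_of_subset_of_nonneg hUsub fun k hk _ =>
      Finset.sum_nonneg fun h _ => Finset.sum_nonneg fun s _ => Finset.sum_nonneg fun a _ =>
        mul_nonneg (occ_nonneg s₁ hP (hπ k hk) _ _ _) (sq_nonneg _)
  have hbound : U.card * (ξ / (4 * Cp)) ^ 2 ≤ H * (4 * H * d * L) := by
    refine hcard.trans ?_
    gcongr
    nlinarith [mul_nonneg (mul_nonneg (zero_le_one.trans hH') hL) (sub_nonneg.2 hd')]
  rw [← le_div_iff₀ (by positivity)] at hbound
  refine hbound.trans_eq ?_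
  field_simp
  ring
end

section
/- Mixture policy optimism (MDP, occupancy form). Let ξ > 0, H > 0, C_p > 0, and B_† ≥ 4·C_p·H/ξ. Let R_sf, R_⋆ ∈ ℝ and v_sf, v_⋆ ∈ [0,∞) satisfy R_sf ≥ 0 and R_⋆ ≤ H. Set α̂ = ξ / (ξ + 4·C_p·v_⋆). Then (1−α̂)·R_sf + α̂·R_⋆ + B_†·((1−α̂)·v_sf + α̂·v_⋆) ≥ R_⋆. -/
/-- **Mixture policy optimism (MDP, occupancy form).**
If `B_† ≥ 4C_pH/ξ`, `R_sf ≥ 0`, `R_⋆ ≤ H`, and `α̂ = ξ/(ξ + 4C_p·v_⋆)`, then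
`(1−α̂)·R_sf + α̂·R_⋆ + B_†·((1−α̂)·v_sf + α̂·v_⋆) ≥ R_⋆`. -/
theorem mixture_policy_optimism_mdp
    (ξ H Cp Bd Rsf Rstar vsf vstar : ℝ)
    (hξ : 0 < ξ) (hH : 0 < H) (hCp : 0 < Cp) (hBd : Bd ≥ 4 * Cp * H / ξ)
    (hvsf : 0 ≤ vsf) (hvstar : 0 ≤ vstar)
    (hRsf : 0 ≤ Rsf) (hRstar : Rstar ≤ H) :
    (1 - ξ / (ξ + 4 * Cp * vstar)) * Rsf + (ξ / (ξ + 4 * Cp * vstar)) * Rstar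
      + Bd * ((1 - ξ / (ξ + 4 * Cp * vstar)) * vsf + (ξ / (ξ + 4 * Cp * vstar)) * vstar)
      ≥ Rstar := by
  have hD : 0 < ξ + 4 * Cp * vstar := by positivity
  have hBd0 : 0 ≤ Bd := le_trans (by positivity) hBd
  set α := ξ / (ξ + 4 * Cp * vstar) with hα
  have hα0 : 0 ≤ α := by positivity
  have hα1 : 0 ≤ 1 - α := by
    rw [hα, sub_nonneg, div_le_one hD]
    have : 0 ≤ 4 * Cp * vstar := by positivity
    linarith
  have hbonus : (1 - α) * H ≤ Bd * (α * vstar) := by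
    calc (1 - α) * H = 4 * Cp * H / ξ * (α * vstar) := by
          rw [hα]
          field_simp
          ring
      _ ≤ Bd * (α * vstar) := by gcongr
  have hgap : (1 - α) * Rstar ≤ (1 - α) * H := by gcongr
  have hsafe : 0 ≤ (1 - α) * Rsf := by positivity
  have hsafeBonus : 0 ≤ Bd * ((1 - α) * vsf) := by positivity
  linarith
end
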